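/- arXiv:1904.07498 — 3 statements merged into one kernel-verified Lean document; each statement's English description precedes it below -/
import Mathlib

section
/- Let A ⊂ ℝ^d be a measurable set of finite positive measure, and suppose the measure of the set of pairs (p,q) ∈ A×A with ‖p−q‖ > 2 equals (1 − 1/(k−1))·λ_d(A)^2, while the set of k-tuples with all pairwise distances > 2 is null. Then A is, up to a λ_d-null set, a disjoint union of k−1 sets A_1,...,A_{k−1} each of measure λ_d(A)/(k−1), each of diameter at most 2, with pairwise distances at least 2. -/
open MeasureTheory ENNReal

/-- A set contains no `m`-clique of the relation `R`. -/
def CliqueFreeOn {α : Type*} (R : Set (α × α)) (m : ℕ) (S : Set α) : Prop :=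
  ∀ p : Fin m → α, (∀ i, p i ∈ S) → ¬ Pairwise fun i j => (p i, p j) ∈ R

theorem CliqueFreeOn.inter_neighbors {α : Type*} {R : Set (α × α)} {m : ℕ} {S : Set α}
    (hsymm : ∀ x y, (x, y) ∈ R → (y, x) ∈ R) (h : CliqueFreeOn R (m + 1) S) {x : α} (hx : x ∈ S) :
    CliqueFreeOn R m (S ∩ Prod.mk x ⁻¹' R) := by
  intro p hp hpair
  refine h (Fin.cons x p) (fun i => ?_) (fun i j hij => ?_)
  · refine Fin.cases hx (fun i => ?_) i
    simpa using (hp i).1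
  · induction i using Fin.cases with
    | zero =>
      induction j using Fin.cases with
      | zero => exact absurd rfl hij
      | succ j => simpa using (hp j).2
    | succ i =>
      induction j using Fin.cases with
      | zero => simpa using hsymm _ _ (hp i).2
      | succ j => simpa using hpair (fun e => hij (by rw [e]))

section Turan

variable {α : Type*} [MeasurableSpace α] {R : Set (α × α)}

theorem measure_restrict_compl_inter (μ : Measure α) {S N : Set α} (hN : MeasurableSet N)
    (hS : μ Sᶜ = 0) : (μ.restrict N) (S ∩ N)ᶜ = 0 := by
  rw [Measure.restrict_apply' hN]
  refine measure_mono_null ?_ hS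
  rintro y ⟨hy, hyN⟩ hyS
  exact hy ⟨hyS, hyN⟩

theorem real_prod_eq_integral (μ : Measure α) [IsFiniteMeasure μ] (hR : MeasurableSet R) :
    (μ.prod μ).real R = ∫ y, μ.real (Prod.mk y ⁻¹' R) ∂μ := by
  rw [measureReal_def, Measure.prod_apply hR,
    ← integral_toReal (measurable_measure_prodMk_left hR).aemeasurable
      (Filter.Eventually.of_forall fun _ => measure_lt_top _ _)]
  rfl

theorem real_prod_inter_left (μ : Measure α) [IsFiniteMeasure μ] (hR : MeasurableSet R)
    {N : Set α} (hN : MeasurableSet N) :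
    (μ.prod μ).real (R ∩ N ×ˢ Set.univ) = ∫ y in N, μ.real (Prod.mk y ⁻¹' R) ∂μ := by
  rw [real_prod_eq_integral μ (hR.inter (hN.prod .univ)), ← integral_indicator hN]
  congr 1
  ext y
  by_cases hy : y ∈ N <;> simp [hy, Set.preimage]

theorem real_prod_inter_right (μ : Measure α) [IsFiniteMeasure μ] (hR : MeasurableSet R)
    (hsymm : ∀ x y, (x, y) ∈ R → (y, x) ∈ R) {M N : Set α} (hM : MeasurableSet M)
    (hN : MeasurableSet N) :
    (μ.prod μ).real (R ∩ M ×ˢ N) = (μ.prod μ).real (R ∩ N ×ˢ M) := by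
  have h := (Measure.measurePreserving_swap (μ := μ) (ν := μ)).measureReal_preimage
    (hR.inter (hN.prod hM)).nullMeasurableSet
  rw [← h]
  congr 1
  ext ⟨x, y⟩
  simp only [Set.mem_inter_iff, Set.mem_prod, Set.mem_preimage, Prod.swap_prod_mk]
  exact ⟨fun ⟨a, b, c⟩ => ⟨hsymm _ _ a, c, b⟩, fun ⟨a, b, c⟩ => ⟨hsymm _ _ a, c, b⟩⟩

theorem real_prod_inter_compl (μ : Measure α) [IsFiniteMeasure μ] (hR : MeasurableSet R)
    (hsymm : ∀ x y, (x, y) ∈ R → (y, x) ∈ R) {N : Set α} (hN : MeasurableSet N) :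
    (μ.prod μ).real (R ∩ Nᶜ ×ˢ Nᶜ) = (μ.prod μ).real (R ∩ N ×ˢ N) + (μ.prod μ).real R
      - 2 * ∫ y in N, μ.real (Prod.mk y ⁻¹' R) ∂μ := by
  have h1 := real_prod_inter_left μ hR hN
  have h2 := real_prod_inter_right μ hR hsymm MeasurableSet.univ hN
  have h3 := measureReal_union_add_inter (μ := μ.prod μ) (s := R ∩ N ×ˢ Set.univ)
    (t := R ∩ Set.univ ×ˢ N) (hR.inter (MeasurableSet.univ.prod hN))
  have h4 : (R ∩ N ×ˢ Set.univ) ∩ (R ∩ Set.univ ×ˢ N) = R ∩ N ×ˢ N := by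
    ext ⟨x, y⟩; simp; tauto
  have h5 := measureReal_inter_add_sdiff (μ := μ.prod μ) (s := R)
    (t := R ∩ N ×ˢ Set.univ ∪ R ∩ Set.univ ×ˢ N)
    ((hR.inter (hN.prod MeasurableSet.univ)).union (hR.inter (MeasurableSet.univ.prod hN)))
  have h6 : R \ (R ∩ N ×ˢ Set.univ ∪ R ∩ Set.univ ×ˢ N) = R ∩ Nᶜ ×ˢ Nᶜ := by
    ext ⟨x, y⟩; simp; tauto
  have h7 : R ∩ (R ∩ N ×ˢ Set.univ ∪ R ∩ Set.univ ×ˢ N)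
      = R ∩ N ×ˢ Set.univ ∪ R ∩ Set.univ ×ˢ N := by
    ext ⟨x, y⟩; simp; tauto
  rw [h4] at h3
  rw [h6, h7] at h5
  linarith

theorem measurable_real_section (μ : Measure α) [IsFiniteMeasure μ] (hR : MeasurableSet R) :
    Measurable fun y => μ.real (Prod.mk y ⁻¹' R) :=
  (measurable_measure_prodMk_left hR).ennreal_toReal

theorem integral_setIntegral_degree (μ : Measure α) [IsFiniteMeasure μ] (hR : MeasurableSet R)
    (hsymm : ∀ x y, (x, y) ∈ R → (y, x) ∈ R) :
    ∫ x, ∫ y in Prod.mk x ⁻¹' R, μ.real (Prod.mk y ⁻¹' R) ∂μ ∂μ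
      = ∫ y, μ.real (Prod.mk y ⁻¹' R) ^ 2 ∂μ := by
  set d : α → ℝ := fun y => μ.real (Prod.mk y ⁻¹' R) with hd
  have hdm : Measurable d := measurable_real_section μ hR
  have hint : Integrable (Function.uncurry fun x y => (Prod.mk x ⁻¹' R).indicator d y)
      (μ.prod μ) := by
    have e : (Function.uncurry fun x y => (Prod.mk x ⁻¹' R).indicator d y)
        = R.indicator fun p => d p.2 := by
      ext ⟨x, y⟩
      by_cases h : (x, y) ∈ R
      · have h' : y ∈ Prod.mk x ⁻¹' R := h
        simp [h, h']
      · have h' : y ∉ Prod.mk x ⁻¹' R := h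
        simp [h, h']
    rw [e]
    refine Integrable.indicator (Integrable.of_bound (hdm.comp measurable_snd).aestronglyMeasurable
      (μ.real Set.univ) (Filter.Eventually.of_forall fun p => ?_)) hR
    rw [Real.norm_of_nonneg measureReal_nonneg]
    exact measureReal_mono (Set.subset_univ _)
  calc ∫ x, ∫ y in Prod.mk x ⁻¹' R, d y ∂μ ∂μ
      = ∫ x, ∫ y, (Prod.mk x ⁻¹' R).indicator d y ∂μ ∂μ := by
        refine integral_congr_ae (Filter.Eventually.of_forall fun x => ?_)
        exact (integral_indicator (measurable_prodMk_left hR)).symm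
    _ = ∫ y, ∫ x, (Prod.mk x ⁻¹' R).indicator d y ∂μ ∂μ := integral_integral_swap hint
    _ = ∫ y, d y ^ 2 ∂μ := by
        refine integral_congr_ae (Filter.Eventually.of_forall fun y => ?_)
        have : (fun x => (Prod.mk x ⁻¹' R).indicator d y)
            = (Prod.mk y ⁻¹' R).indicator fun _ => d y := by
          ext x
          by_cases h : (x, y) ∈ R
          · have h₁ : y ∈ Prod.mk x ⁻¹' R := h
            have h₂ : x ∈ Prod.mk y ⁻¹' R := hsymm _ _ h
            simp [h₁, h₂]
          · have h₁ : y ∉ Prod.mk x ⁻¹' R := h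
            have h₂ : x ∉ Prod.mk y ⁻¹' R := fun h' => h (hsymm _ _ h')
            simp [h₁, h₂]
        simp only [this]
        rw [integral_indicator_const _ (measurable_prodMk_left hR), smul_eq_mul, sq]

theorem integrable_real_section {β : Type*} [MeasurableSpace β] (μ : Measure α)
    [IsFiniteMeasure μ] (ν : Measure β) [IsFiniteMeasure ν] {T : Set (α × β)}
    (hT : MeasurableSet T) : Integrable (fun y => ν.real (Prod.mk y ⁻¹' T)) μ := by
  refine Integrable.of_bound (measurable_measure_prodMk_left hT).ennreal_toReal.aestronglyMeasurable
    (ν.real Set.univ) (Filter.Eventually.of_forall fun p => ?_)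
  rw [Real.norm_of_nonneg measureReal_nonneg]
  exact measureReal_mono (Set.subset_univ _)

theorem integrable_real_section_sq (μ : Measure α) [IsFiniteMeasure μ] (hR : MeasurableSet R) :
    Integrable (fun y => μ.real (Prod.mk y ⁻¹' R) ^ 2) μ := by
  refine Integrable.of_bound ((measurable_real_section μ hR).pow_const 2).aestronglyMeasurable
    (μ.real Set.univ ^ 2) (Filter.Eventually.of_forall fun p => ?_)
  rw [Real.norm_of_nonneg (by positivity)]
  exact pow_le_pow_left₀ measureReal_nonneg (measureReal_mono (Set.subset_univ _)) 2

theorem integrable_real_prod_inter_neighbors (μ : Measure α) [IsFiniteMeasure μ]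
    (hR : MeasurableSet R) :
    Integrable (fun x => (μ.prod μ).real (R ∩ (Prod.mk x ⁻¹' R) ×ˢ (Prod.mk x ⁻¹' R))) μ := by
  have hm : MeasurableSet {t : α × (α × α) | t.2 ∈ R ∧ (t.1, t.2.1) ∈ R ∧ (t.1, t.2.2) ∈ R} :=
    (measurable_snd hR).inter
      (((by fun_prop : Measurable fun t : α × (α × α) => (t.1, t.2.1)) hR).inter
      ((by fun_prop : Measurable fun t : α × (α × α) => (t.1, t.2.2)) hR))
  exact integrable_real_section μ (μ.prod μ) hm

theorem integrable_setIntegral_degree (μ : Measure α) [IsFiniteMeasure μ] (hR : MeasurableSet R) :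
    Integrable (fun x => ∫ y in Prod.mk x ⁻¹' R, μ.real (Prod.mk y ⁻¹' R) ∂μ) μ := by
  have hm : MeasurableSet {t : α × (α × α) | t.2 ∈ R ∧ (t.1, t.2.1) ∈ R} :=
    (measurable_snd hR).inter ((by fun_prop : Measurable fun t : α × (α × α) => (t.1, t.2.1)) hR)
  have e : (fun x => ∫ y in Prod.mk x ⁻¹' R, μ.real (Prod.mk y ⁻¹' R) ∂μ)
      = fun x => (μ.prod μ).real
        (Prod.mk x ⁻¹' {t : α × (α × α) | t.2 ∈ R ∧ (t.1, t.2.1) ∈ R}) := by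
    ext x
    rw [← real_prod_inter_left μ hR (measurable_prodMk_left hR)]
    congr 1
    ext ⟨y, z⟩
    simp
  rw [e]
  exact integrable_real_section μ (μ.prod μ) hm

theorem integral_real_prod_inter_compl_neighbors (μ : Measure α) [IsFiniteMeasure μ]
    (hR : MeasurableSet R) (hsymm : ∀ x y, (x, y) ∈ R → (y, x) ∈ R) :
    ∫ x, (μ.prod μ).real (R ∩ (Prod.mk x ⁻¹' R)ᶜ ×ˢ (Prod.mk x ⁻¹' R)ᶜ) ∂μ
      = ∫ x, (μ.prod μ).real (R ∩ (Prod.mk x ⁻¹' R) ×ˢ (Prod.mk x ⁻¹' R)) ∂μ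
        + μ.real Set.univ * (μ.prod μ).real R - 2 * ∫ x, μ.real (Prod.mk x ⁻¹' R) ^ 2 ∂μ := by
  simp_rw [fun x => real_prod_inter_compl μ hR hsymm (measurable_prodMk_left (x := x) hR)]
  rw [integral_sub, integral_add, integral_const, integral_const_mul,
    integral_setIntegral_degree μ hR hsymm, smul_eq_mul]
  · exact integrable_real_prod_inter_neighbors μ hR
  · exact integrable_const _
  · exact (integrable_real_prod_inter_neighbors μ hR).add (integrable_const _)
  · exact (integrable_setIntegral_degree μ hR).const_mul 2

theorem integral_sub_const_sq (μ : Measure α) [IsFiniteMeasure μ] {f : α → ℝ}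
    (hf : Integrable f μ) (hf2 : Integrable (fun x => f x ^ 2) μ) (c : ℝ) :
    ∫ x, (f x - c) ^ 2 ∂μ = ∫ x, f x ^ 2 ∂μ - 2 * c * ∫ x, f x ∂μ + μ.real Set.univ * c ^ 2 := by
  have e : (fun x => (f x - c) ^ 2) = fun x => f x ^ 2 - 2 * c * f x + c ^ 2 := by
    ext x; ring
  rw [e, integral_add _ (integrable_const _), integral_sub hf2 (hf.const_mul _),
    integral_const_mul, integral_const, smul_eq_mul]
  exact hf2.sub (hf.const_mul _)

theorem integrable_sub_const_sq (μ : Measure α) [IsFiniteMeasure μ] {f : α → ℝ}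
    (hf : Integrable f μ) (hf2 : Integrable (fun x => f x ^ 2) μ) (c : ℝ) :
    Integrable (fun x => (f x - c) ^ 2) μ := by
  have e : (fun x => (f x - c) ^ 2) = fun x => f x ^ 2 - 2 * c * f x + c ^ 2 := by
    ext x; ring
  rw [e]
  exact (hf2.sub (hf.const_mul _)).add (integrable_const _)

theorem real_prod_restrict (μ : Measure α) [IsFiniteMeasure μ] {N : Set α} {T : Set (α × α)}
    (hT : MeasurableSet T) :
    ((μ.restrict N).prod (μ.restrict N)).real T = (μ.prod μ).real (T ∩ N ×ˢ N) := by
  rw [Measure.prod_restrict, measureReal_restrict_apply hT]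

theorem CliqueFreeOn.real_prod_eq_zero (μ : Measure α) [IsFiniteMeasure μ] {S : Set α}
    (hsymm : ∀ x y, (x, y) ∈ R → (y, x) ∈ R) (hS : μ Sᶜ = 0) (h : CliqueFreeOn R 2 S) :
    (μ.prod μ).real R = 0 := by
  have hnull : (μ.prod μ) (Sᶜ ×ˢ Set.univ ∪ Set.univ ×ˢ Sᶜ) = 0 := by
    simp [Measure.prod_prod, hS]
  rw [measureReal_def, measure_mono_null _ hnull, ENNReal.toReal_zero]
  rintro ⟨x, y⟩ hxy
  by_contra hc
  simp only [Set.mem_union, Set.mem_prod, Set.mem_compl_iff, Set.mem_univ, and_true, true_and,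
    not_or, not_not] at hc
  refine h ![x, y] (fun i => ?_) (fun i j hij => ?_)
  · fin_cases i
    · exact hc.1
    · exact hc.2
  · fin_cases i <;> fin_cases j
    · exact absurd rfl hij
    · exact hxy
    · exact hsymm _ _ hxy
    · exact absurd rfl hij

/-- Turán's bound for the edge density of a measurable relation. -/
theorem CliqueFreeOn.turan_bound (hR : MeasurableSet R)
    (hsymm : ∀ x y, (x, y) ∈ R → (y, x) ∈ R) (n : ℕ) :
    ∀ (μ : Measure α) [IsFiniteMeasure μ] (S : Set α), μ Sᶜ = 0 → CliqueFreeOn R (n + 2) S →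
      (n + 1 : ℝ) * (μ.prod μ).real R ≤ n * μ.real Set.univ ^ 2 := by
  induction n with
  | zero =>
    intro μ _ S hS h
    simp [h.real_prod_eq_zero μ hsymm hS]
  | succ n ih =>
    intro μ _ S hS h
    have hp : ∀ᵐ x ∂μ, (n + 1 : ℝ) * (μ.prod μ).real (R ∩ (Prod.mk x ⁻¹' R) ×ˢ (Prod.mk x ⁻¹' R))
        ≤ n * μ.real (Prod.mk x ⁻¹' R) ^ 2 := by
      have hS' : ∀ᵐ x ∂μ, x ∈ S := hS
      filter_upwards [hS'] with x hx
      have hN := measurable_prodMk_left (x := x) hR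
      have := ih (μ.restrict (Prod.mk x ⁻¹' R)) _ (measure_restrict_compl_inter μ hN hS)
        (h.inter_neighbors hsymm hx)
      rwa [real_prod_restrict μ hR, measureReal_restrict_apply_univ] at this
    have hp' := integral_mono_ae ((integrable_real_prod_inter_neighbors μ hR).const_mul _)
      ((integrable_real_section_sq μ hR).const_mul _) hp
    rw [integral_const_mul, integral_const_mul] at hp'
    have hq := integral_real_prod_inter_compl_neighbors μ hR hsymm
    have hq0 : 0 ≤ ∫ x, (μ.prod μ).real (R ∩ (Prod.mk x ⁻¹' R)ᶜ ×ˢ (Prod.mk x ⁻¹' R)ᶜ) ∂μ :=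
      integral_nonneg fun _ => measureReal_nonneg
    have hd := integral_sub_const_sq μ (integrable_real_section μ μ hR)
      (integrable_real_section_sq μ hR)
    have hE := real_prod_eq_integral μ hR
    rw [← hE] at hd
    set m := μ.real Set.univ with hm
    have hm0 : 0 ≤ m := measureReal_nonneg
    set E := (μ.prod μ).real R
    have hE0 : 0 ≤ E := measureReal_nonneg
    set P := ∫ x, (μ.prod μ).real (R ∩ (Prod.mk x ⁻¹' R) ×ˢ (Prod.mk x ⁻¹' R)) ∂μ
    set D := ∫ x, μ.real (Prod.mk x ⁻¹' R) ^ 2 ∂μ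
    rw [hq] at hq0
    push_cast
    rcases hm0.eq_or_lt with h0 | hmpos
    · have hμ : μ = 0 := by
        rw [← Measure.measure_univ_eq_zero]
        exact (measureReal_eq_zero_iff).1 h0.symm
      have : E = 0 := by simp [E, hμ]
      rw [this]
      nlinarith [sq_nonneg m, Nat.cast_nonneg (α := ℝ) n]
    have hDE : E ^ 2 ≤ m * D := by
      have h1 := hd (E / m)
      have h2 : 0 ≤ ∫ x, (μ.real (Prod.mk x ⁻¹' R) - E / m) ^ 2 ∂μ :=
        integral_nonneg fun _ => sq_nonneg _
      rw [h1] at h2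
      have h3 : m * (D - 2 * (E / m) * E + m * (E / m) ^ 2) = m * D - E ^ 2 := by
        field_simp; ring
      nlinarith
    have h4 : (n + 2 : ℝ) * D ≤ (n + 1) * (m * E) := by nlinarith [Nat.cast_nonneg (α := ℝ) n]
    rcases hE0.eq_or_lt with h0 | hEpos
    · rw [← h0]; simp; positivity
    have h5 : ((n + 2 : ℝ) * E) * E ≤ ((n + 1) * m ^ 2) * E := by
      nlinarith [mul_le_mul_of_nonneg_left hDE (by positivity : (0 : ℝ) ≤ n + 2),
        mul_le_mul_of_nonneg_left h4 hm0]
    have := le_of_mul_le_mul_right h5 hEpos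
    linarith

/-- In the equality case of Turán's bound almost every point has the average degree, its
neighborhood attains the bound for one part less, and its non-neighborhood spans no edges. -/
theorem CliqueFreeOn.ae_of_turan_eq (hR : MeasurableSet R)
    (hsymm : ∀ x y, (x, y) ∈ R → (y, x) ∈ R) (n : ℕ) (μ : Measure α) [IsFiniteMeasure μ]
    {S : Set α} (hS : μ Sᶜ = 0) (h : CliqueFreeOn R (n + 3) S)
    (hE : (n + 2 : ℝ) * (μ.prod μ).real R = (n + 1) * μ.real Set.univ ^ 2) :
    ∀ᵐ x ∂μ, (n + 2 : ℝ) * μ.real (Prod.mk x ⁻¹' R) = (n + 1) * μ.real Set.univ ∧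
      (n + 1 : ℝ) * (μ.prod μ).real (R ∩ (Prod.mk x ⁻¹' R) ×ˢ (Prod.mk x ⁻¹' R))
        = n * μ.real (Prod.mk x ⁻¹' R) ^ 2 ∧
      (μ.prod μ).real (R ∩ (Prod.mk x ⁻¹' R)ᶜ ×ˢ (Prod.mk x ⁻¹' R)ᶜ) = 0 := by
  have hS' : ∀ᵐ x ∂μ, x ∈ S := hS
  have hp : ∀ᵐ x ∂μ, 0 ≤ n * μ.real (Prod.mk x ⁻¹' R) ^ 2
      - (n + 1 : ℝ) * (μ.prod μ).real (R ∩ (Prod.mk x ⁻¹' R) ×ˢ (Prod.mk x ⁻¹' R)) := by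
    filter_upwards [hS'] with x hx
    have hN := measurable_prodMk_left (x := x) hR
    have := CliqueFreeOn.turan_bound hR hsymm n (μ.restrict (Prod.mk x ⁻¹' R)) _
      (measure_restrict_compl_inter μ hN hS) (h.inter_neighbors hsymm hx)
    rw [real_prod_restrict μ hR, measureReal_restrict_apply_univ] at this
    linarith
  have hdi := integrable_real_section μ μ hR
  have hd2i := integrable_real_section_sq μ hR
  have hpi := integrable_real_prod_inter_neighbors μ hR
  have hgi : Integrable (fun x => n * μ.real (Prod.mk x ⁻¹' R) ^ 2
      - (n + 1 : ℝ) * (μ.prod μ).real (R ∩ (Prod.mk x ⁻¹' R) ×ˢ (Prod.mk x ⁻¹' R))) μ :=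
    (hd2i.const_mul _).sub (hpi.const_mul _)
  have hqi : Integrable (fun x =>
      (μ.prod μ).real (R ∩ (Prod.mk x ⁻¹' R)ᶜ ×ˢ (Prod.mk x ⁻¹' R)ᶜ)) μ := by
    simp_rw [fun x => real_prod_inter_compl μ hR hsymm (measurable_prodMk_left (x := x) hR)]
    exact (hpi.add (integrable_const _)).sub ((integrable_setIntegral_degree μ hR).const_mul 2)
  have hg : ∫ x, (n * μ.real (Prod.mk x ⁻¹' R) ^ 2
      - (n + 1 : ℝ) * (μ.prod μ).real (R ∩ (Prod.mk x ⁻¹' R) ×ˢ (Prod.mk x ⁻¹' R))) ∂μ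
      = n * ∫ x, μ.real (Prod.mk x ⁻¹' R) ^ 2 ∂μ - (n + 1) *
        ∫ x, (μ.prod μ).real (R ∩ (Prod.mk x ⁻¹' R) ×ˢ (Prod.mk x ⁻¹' R)) ∂μ := by
    rw [integral_sub (hd2i.const_mul _) (hpi.const_mul _), integral_const_mul, integral_const_mul]
  have hg0 := integral_nonneg_of_ae hp
  have hq := integral_real_prod_inter_compl_neighbors μ hR hsymm
  have hq0 : 0 ≤ ∫ x, (μ.prod μ).real (R ∩ (Prod.mk x ⁻¹' R)ᶜ ×ˢ (Prod.mk x ⁻¹' R)ᶜ) ∂μ :=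
    integral_nonneg fun _ => measureReal_nonneg
  have hdI := real_prod_eq_integral μ hR
  have hc := integral_sub_const_sq μ hdi hd2i ((n + 1) / (n + 2) * μ.real Set.univ)
  have hci := integrable_sub_const_sq μ hdi hd2i ((n + 1) / (n + 2) * μ.real Set.univ)
  have hc0 : 0 ≤ ∫ x, (μ.real (Prod.mk x ⁻¹' R) - (n + 1) / (n + 2) * μ.real Set.univ) ^ 2 ∂μ :=
    integral_nonneg fun _ => sq_nonneg _
  have hn : (0 : ℝ) < n + 2 := by positivity
  have hE' : (μ.prod μ).real R = (n + 1) / (n + 2) * μ.real Set.univ ^ 2 := by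
    field_simp; linarith
  -- the three nonnegative integrals have a vanishing positive combination
  have hsum : (n + 1) * ∫ x, (μ.prod μ).real (R ∩ (Prod.mk x ⁻¹' R)ᶜ ×ˢ (Prod.mk x ⁻¹' R)ᶜ) ∂μ
      + ∫ x, (n * μ.real (Prod.mk x ⁻¹' R) ^ 2
        - (n + 1 : ℝ) * (μ.prod μ).real (R ∩ (Prod.mk x ⁻¹' R) ×ˢ (Prod.mk x ⁻¹' R))) ∂μ
      + (n + 2) * ∫ x, (μ.real (Prod.mk x ⁻¹' R) - (n + 1) / (n + 2) * μ.real Set.univ) ^ 2 ∂μ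
      = 0 := by
    rw [hq, hg, hc, ← hdI, hE']
    field_simp
    ring
  have hn1 : (0 : ℝ) < n + 1 := by positivity
  have hqz : ∫ x, (μ.prod μ).real (R ∩ (Prod.mk x ⁻¹' R)ᶜ ×ˢ (Prod.mk x ⁻¹' R)ᶜ) ∂μ = 0 := by
    nlinarith
  have hcz : ∫ x, (μ.real (Prod.mk x ⁻¹' R) - (n + 1) / (n + 2) * μ.real Set.univ) ^ 2 ∂μ = 0 := by
    nlinarith
  have hgz := le_antisymm (by nlinarith) hg0
  have hq_ae := (integral_eq_zero_iff_of_nonneg (fun _ => measureReal_nonneg) hqi).1 hqz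
  have hc_ae := (integral_eq_zero_iff_of_nonneg (fun _ => sq_nonneg _) hci).1 hcz
  have hg_ae := (integral_eq_zero_iff_of_nonneg_ae hp hgi).1 hgz
  filter_upwards [hq_ae, hc_ae, hg_ae] with x h1 h2 h3
  simp only [Pi.zero_apply] at h1 h2 h3
  refine ⟨?_, by linarith, h1⟩
  have := pow_eq_zero_iff (two_ne_zero) |>.1 h2
  rw [sub_eq_zero.1 this]
  field_simp

theorem real_prod_diff_eq_zero (μ : Measure α) [IsFiniteMeasure μ] (hR : MeasurableSet R)
    (hsymm : ∀ x y, (x, y) ∈ R → (y, x) ∈ R) {N : Set α} (hN : MeasurableSet N)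
    (hq : (μ.prod μ).real (R ∩ Nᶜ ×ˢ Nᶜ) = 0)
    (hE : (μ.prod μ).real R = (μ.prod μ).real (R ∩ N ×ˢ N) + 2 * (μ.real N * μ.real Nᶜ)) :
    (μ.prod μ).real (N ×ˢ Nᶜ \ R) = 0 := by
  have h1 := real_prod_inter_compl μ hR hsymm hN
  have h2 := real_prod_inter_left μ hR hN
  have h3 := measureReal_inter_add_sdiff (μ := μ.prod μ) (s := R ∩ N ×ˢ Set.univ)
    (MeasurableSet.univ.prod hN : MeasurableSet (Set.univ ×ˢ N : Set (α × α)))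
  have h4 : R ∩ N ×ˢ Set.univ ∩ Set.univ ×ˢ N = R ∩ N ×ˢ N := by
    ext ⟨x, y⟩; simp; tauto
  have h5 : (R ∩ N ×ˢ Set.univ) \ Set.univ ×ˢ N = N ×ˢ Nᶜ ∩ R := by
    ext ⟨x, y⟩; simp; tauto
  have h6 := measureReal_inter_add_sdiff (μ := μ.prod μ) (s := N ×ˢ Nᶜ) hR
  rw [measureReal_prod_prod] at h6
  rw [h4, h5] at h3
  linarith

/-- A finite measure attaining Turán's bound is a balanced complete multipartite graph. -/
theorem CliqueFreeOn.exists_partition_of_turan_eq (hR : MeasurableSet R)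
    (hsymm : ∀ x y, (x, y) ∈ R → (y, x) ∈ R) (n : ℕ) :
    ∀ (μ : Measure α) [IsFiniteMeasure μ] (S : Set α), μ Sᶜ = 0 → CliqueFreeOn R (n + 2) S →
      0 < μ.real Set.univ → (n + 1 : ℝ) * (μ.prod μ).real R = n * μ.real Set.univ ^ 2 →
      ∃ B : Fin (n + 1) → Set α, (∀ i, MeasurableSet (B i)) ∧
        (Pairwise fun i j => Disjoint (B i) (B j)) ∧ ⋃ i, B i = Set.univ ∧
        (∀ i, (n + 1 : ℝ) * μ.real (B i) = μ.real Set.univ) ∧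
        (∀ i, (μ.prod μ).real (R ∩ B i ×ˢ B i) = 0) ∧
        ∀ i j, i ≠ j → (μ.prod μ).real (B i ×ˢ B j \ R) = 0 := by
  induction n with
  | zero =>
    intro μ _ S hS h hm _
    refine ⟨fun _ => Set.univ, fun _ => MeasurableSet.univ,
      fun i j hij => absurd (Subsingleton.elim (α := Fin 1) i j) hij, Set.iUnion_const _, fun _ => by simp,
      fun _ => ?_, fun i j hij => absurd (Subsingleton.elim (α := Fin 1) i j) hij⟩
    simp [h.real_prod_eq_zero μ hsymm hS]
  | succ n ih =>
    intro μ _ S hS h hm hE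
    have hμ : NeZero μ := ⟨by rintro rfl; simp at hm⟩
    push_cast at hE
    rw [add_assoc, one_add_one_eq_two] at hE
    have hS' : ∀ᵐ x ∂μ, x ∈ S := hS
    obtain ⟨x, hx, hd, hp, hq⟩ := (hS'.and (h.ae_of_turan_eq hR hsymm n μ hS hE)).exists
    have hN : MeasurableSet (Prod.mk x ⁻¹' R) := measurable_prodMk_left hR
    have hfree := h.inter_neighbors hsymm hx
    set N := Prod.mk x ⁻¹' R with hNdef
    have hc : μ.real N + μ.real Nᶜ = μ.real Set.univ := measureReal_add_measureReal_compl hN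
    have hn : (0 : ℝ) < n + 2 := by positivity
    have hn1 : (0 : ℝ) < n + 1 := by positivity
    have hd' : μ.real N = (n + 1) / (n + 2) * μ.real Set.univ := by field_simp; linarith
    have hcross : (μ.prod μ).real (N ×ˢ Nᶜ \ R) = 0 := by
      refine real_prod_diff_eq_zero μ hR hsymm hN hq ?_
      have e1 : (μ.prod μ).real R = (n + 1) / (n + 2) * μ.real Set.univ ^ 2 := by
        field_simp; linarith
      have e2 : (μ.prod μ).real (R ∩ N ×ˢ N) = n / (n + 1) * μ.real N ^ 2 := by
        field_simp; linarith
      have e3 : μ.real Nᶜ = μ.real Set.univ - μ.real N := by linarith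
      rw [e1, e2, e3, hd']
      field_simp
      ring
    have hcross' : (μ.prod μ).real (Nᶜ ×ˢ N \ R) = 0 := by
      have hsymm' : ∀ a b, (a, b) ∈ Rᶜ → (b, a) ∈ Rᶜ := fun a b hab hba => hab (hsymm _ _ hba)
      rw [Set.sdiff_eq, Set.inter_comm] at hcross ⊢
      rw [real_prod_inter_right μ hR.compl hsymm' hN.compl hN, hcross]
    obtain ⟨B, hBm, hBd, hBu, hBv, hBi, hBc⟩ := ih (μ.restrict N) _
      (measure_restrict_compl_inter μ hN hS) hfree
      (by rw [measureReal_restrict_apply_univ, hd']; positivity)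
      (by rwa [measureReal_restrict_apply_univ, real_prod_restrict μ hR])
    have hnull : ∀ {T U : Set (α × α)}, T ⊆ U → (μ.prod μ).real U = 0 →
        (μ.prod μ).real T = 0 := fun hTU hU =>
      le_antisymm (hU ▸ measureReal_mono hTU) measureReal_nonneg
    refine ⟨Fin.cons Nᶜ fun i => B i ∩ N, fun i => ?_, fun i j hij => ?_, ?_, fun i => ?_,
      fun i => ?_, fun i j hij => ?_⟩
    · induction i using Fin.cases with
      | zero => exact hN.compl
      | succ i => exact (hBm i).inter hN
    · induction i using Fin.cases with
      | zero =>
        induction j using Fin.cases with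
        | zero => exact absurd rfl hij
        | succ j => exact disjoint_compl_left.mono_right Set.inter_subset_right
      | succ i =>
        induction j using Fin.cases with
        | zero => exact disjoint_compl_right.mono_left Set.inter_subset_right
        | succ j =>
          exact (hBd fun e => hij (congrArg Fin.succ e)).mono Set.inter_subset_left Set.inter_subset_left
    · refine Set.eq_univ_of_forall fun y => ?_
      by_cases hy : y ∈ N
      · obtain ⟨i, hi⟩ := Set.mem_iUnion.1 (hBu ▸ Set.mem_univ y)
        exact Set.mem_iUnion.2 ⟨i.succ, hi, hy⟩
      · exact Set.mem_iUnion.2 ⟨0, hy⟩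
    · push_cast
      induction i using Fin.cases with
      | zero =>
        rw [Fin.cons_zero, eq_sub_of_add_eq' hc, hd']
        field_simp
        ring
      | succ i =>
        have := hBv i
        rw [measureReal_restrict_apply_univ, measureReal_restrict_apply (hBm i), hd'] at this
        simp only [Fin.cons_succ]
        field_simp at this
        linarith
    · induction i using Fin.cases with
      | zero => exact hq
      | succ i =>
        have := hBi i
        rw [real_prod_restrict μ (hR.inter ((hBm i).prod (hBm i)))] at this
        refine hnull ?_ this
        rintro ⟨a, b⟩ ⟨hab, ⟨ha, haN⟩, hb, hbN⟩
        exact ⟨⟨hab, ha, hb⟩, haN, hbN⟩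
    · induction i using Fin.cases with
      | zero =>
        induction j using Fin.cases with
        | zero => exact absurd rfl hij
        | succ j =>
          refine hnull ?_ hcross'
          rintro ⟨a, b⟩ ⟨⟨ha, hb⟩, hab⟩
          exact ⟨⟨ha, hb.2⟩, hab⟩
      | succ i =>
        induction j using Fin.cases with
        | zero =>
          refine hnull ?_ hcross
          rintro ⟨a, b⟩ ⟨⟨ha, hb⟩, hab⟩
          exact ⟨⟨ha.2, hb⟩, hab⟩
        | succ j =>
          have := hBc i j fun e => hij (congrArg Fin.succ e)
          rw [real_prod_restrict μ (((hBm i).prod (hBm j)).diff hR)] at this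
          refine hnull ?_ this
          rintro ⟨a, b⟩ ⟨⟨ha, hb⟩, hab⟩
          exact ⟨⟨⟨ha.1, hb.1⟩, hab⟩, ha.2, hb.2⟩

end Turan

section Support

variable {X : Type*} [TopologicalSpace X] [MeasurableSpace X] [OpensMeasurableSpace X]

theorem prod_inter_pos_of_mem_support (μ : Measure X) [SFinite μ] {B C : Set X}
    {O : Set (X × X)} (hO : IsOpen O) {x y : X} (hx : x ∈ (μ.restrict B).support)
    (hy : y ∈ (μ.restrict C).support) (hxy : (x, y) ∈ O) : 0 < (μ.prod μ) (O ∩ B ×ˢ C) := by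
  obtain ⟨u, v, hu, hxu, hv, hyv, huv⟩ := mem_nhds_prod_iff'.1 (hO.mem_nhds hxy)
  have h1 := (Measure.mem_support_iff_forall x).1 hx u (hu.mem_nhds hxu)
  have h2 := (Measure.mem_support_iff_forall y).1 hy v (hv.mem_nhds hyv)
  rw [Measure.restrict_apply hu.measurableSet] at h1
  rw [Measure.restrict_apply hv.measurableSet] at h2
  calc 0 < μ (u ∩ B) * μ (v ∩ C) := ENNReal.mul_pos h1.ne' h2.ne'
    _ = (μ.prod μ) ((u ∩ B) ×ˢ (v ∩ C)) := (Measure.prod_prod _ _).symm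
    _ ≤ (μ.prod μ) (O ∩ B ×ˢ C) := by
      refine measure_mono ?_
      rintro ⟨a, b⟩ ⟨⟨ha, ha'⟩, hb, hb'⟩
      exact ⟨huv ⟨ha, hb⟩, ha', hb'⟩

theorem cliqueFreeOn_support (μ : Measure X) [SigmaFinite μ] {A : Set X} {R : Set (X × X)}
    (hR : IsOpen R) {k : ℕ}
    (hfree : Measure.pi (fun _ : Fin k => μ)
      {p | (∀ i, p i ∈ A) ∧ ∀ i j, i ≠ j → (p i, p j) ∈ R} = 0) :
    CliqueFreeOn R k (μ.restrict A).support := by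
  intro p hp hpair
  have hO : IsOpen {q : Fin k → X | ∀ i j, i ≠ j → (q i, q j) ∈ R} := by
    simp only [Set.ofPred_forall]
    refine isOpen_iInter_of_finite fun i => isOpen_iInter_of_finite fun j =>
      isOpen_iInter_of_finite fun _ => hR.preimage (by fun_prop)
  obtain ⟨u, hu, huO⟩ := isOpen_pi_iff'.1 hO p fun i j hij => hpair hij
  refine absurd hfree (ne_of_gt (lt_of_lt_of_le ?_
    (measure_mono (s := Set.univ.pi fun i => u i ∩ A) fun q hq => ⟨fun i => (hq i trivial).2,
      huO fun i _ => (hq i trivial).1⟩)))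
  rw [Measure.pi_pi]
  refine pos_iff_ne_zero.2 (Finset.prod_ne_zero_iff.2 fun i _ => ne_of_gt ?_)
  have := (Measure.mem_support_iff_forall _).1 (hp i) (u i) ((hu i).1.mem_nhds (hu i).2)
  rwa [Measure.restrict_apply (hu i).1.measurableSet] at this

end Support

theorem one_sub_one_div_natCast_succ_toReal (n : ℕ) :
    (1 - 1 / ((n + 1 : ℕ) : ℝ≥0∞)).toReal = n / (n + 1) := by
  have h : 1 / ((n + 1 : ℕ) : ℝ≥0∞) ≤ 1 := by
    rw [one_div, ENNReal.inv_le_one]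
    exact_mod_cast Nat.le_add_left 1 n
  rw [ENNReal.toReal_sub_of_le h ENNReal.one_ne_top]
  simp only [one_div, ENNReal.toReal_one, ENNReal.toReal_inv, ENNReal.toReal_natCast]
  push_cast
  field_simp
  ring

theorem stmt2 (d k : ℕ) (hk : 2 ≤ k) (A : Set (EuclideanSpace ℝ (Fin d)))
    (hA : MeasurableSet A) (hpos : 0 < volume A) (hfin : volume A < ⊤)
    (hedge : volume {p : EuclideanSpace ℝ (Fin d) × EuclideanSpace ℝ (Fin d) |
        p.1 ∈ A ∧ p.2 ∈ A ∧ 2 < dist p.1 p.2}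
      = (1 - 1 / ((k : ℝ≥0∞) - 1)) * (volume A) ^ 2)
    (hfree : volume {p : Fin k → EuclideanSpace ℝ (Fin d) |
      (∀ i, p i ∈ A) ∧ ∀ i j, i ≠ j → 2 < dist (p i) (p j)} = 0) :
    ∃ B : Fin (k - 1) → Set (EuclideanSpace ℝ (Fin d)),
      (Pairwise fun i j => Disjoint (B i) (B j)) ∧
      (∀ i, volume (B i) = volume A / ((k : ℝ≥0∞) - 1)) ∧
      (∀ i, EMetric.diam (B i) ≤ 2) ∧
      (∀ i j, i ≠ j → ∀ x ∈ B i, ∀ y ∈ B j, 2 ≤ dist x y) ∧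
      volume (symmDiff A (⋃ i, B i)) = 0 := by
  obtain ⟨n, rfl⟩ : ∃ n, k = n + 2 := ⟨k - 2, by omega⟩
  have hcast : ((n + 2 : ℕ) : ℝ≥0∞) - 1 = ((n + 1 : ℕ) : ℝ≥0∞) := by
    rw [show ((n + 2 : ℕ) : ℝ≥0∞) = ((n + 1 : ℕ) : ℝ≥0∞) + 1 by push_cast; ring]
    exact ENNReal.add_sub_cancel_right ENNReal.one_ne_top
  rw [hcast] at hedge ⊢
  change ∃ B : Fin (n + 1) → Set (EuclideanSpace ℝ (Fin d)), _
  set R : Set (EuclideanSpace ℝ (Fin d) × EuclideanSpace ℝ (Fin d)) :=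
    {p | 2 < dist p.1 p.2} with hRdef
  have hRo : IsOpen R := isOpen_lt continuous_const continuous_dist
  have hR : MeasurableSet R := hRo.measurableSet
  have hsymm : ∀ x y, (x, y) ∈ R → (y, x) ∈ R := fun x y h => by
    simpa [hRdef, dist_comm] using h
  set μ := (volume : Measure (EuclideanSpace ℝ (Fin d))).restrict A with hμ
  have : IsFiniteMeasure μ := isFiniteMeasure_restrict.2 hfin.ne
  have huniv : μ.real Set.univ = volume.real A := measureReal_restrict_apply_univ A
  have hE : (n + 1 : ℝ) * (μ.prod μ).real R = n * μ.real Set.univ ^ 2 := by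
    have e : R ∩ A ×ˢ A = {p | p.1 ∈ A ∧ p.2 ∈ A ∧ 2 < dist p.1 p.2} := by
      ext ⟨x, y⟩
      simp [hRdef]
      tauto
    rw [huniv, hμ, Measure.prod_restrict, measureReal_restrict_apply hR, e, measureReal_def,
      ← Measure.volume_eq_prod, hedge, ENNReal.toReal_mul, one_sub_one_div_natCast_succ_toReal,
      ENNReal.toReal_pow, measureReal_def]
    field_simp
  obtain ⟨B, hBm, hBd, hBu, hBv, hBi, hBc⟩ :=
    CliqueFreeOn.exists_partition_of_turan_eq hR hsymm n μ _ Measure.measure_compl_support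
      (cliqueFreeOn_support volume hRo hfree)
      (by rw [huniv]; exact ENNReal.toReal_pos hpos.ne' hfin.ne) hE
  have hnull : ∀ i, volume ((A ∩ B i) \ (μ.restrict (B i)).support) = 0 := fun i => by
    have := Measure.measure_compl_support (μ := μ.restrict (B i))
    rw [hμ, Measure.restrict_restrict (hBm i), Measure.restrict_apply' ((hBm i).inter hA)] at this
    refine measure_mono_null ?_ this
    rintro x ⟨⟨hxA, hxB⟩, hx⟩
    rw [hμ, Measure.restrict_restrict (hBm i)] at hx
    exact ⟨hx, hxB, hxA⟩
  refine ⟨fun i => A ∩ B i ∩ (μ.restrict (B i)).support, fun i j hij => ?_, fun i => ?_,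
    fun i => ?_, fun i j hij x hx y hy => ?_, ?_⟩
  · exact (hBd hij).mono (Set.inter_subset_left.trans Set.inter_subset_right)
      (Set.inter_subset_left.trans Set.inter_subset_right)
  · have h1 : volume (A ∩ B i ∩ (μ.restrict (B i)).support) = volume (A ∩ B i) := by
      have := measure_sdiff_null (μ := volume) (s := A ∩ B i) (hnull i)
      rwa [Set.sdiff_sdiff_right_self] at this
    have h2 := hBv i
    rw [huniv, hμ, measureReal_restrict_apply (hBm i), Set.inter_comm] at h2
    have h3 : volume (A ∩ B i) ≠ ⊤ := measure_ne_top_of_subset Set.inter_subset_left hfin.ne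
    rw [h1, ENNReal.eq_div_iff (by simp) (by simp), ← ENNReal.toReal_eq_toReal_iff'
      (ENNReal.mul_ne_top (by simp) h3) hfin.ne, ENNReal.toReal_mul, ENNReal.toReal_natCast]
    push_cast
    exact h2
  · refine Metric.ediam_le fun x hx y hy => ?_
    rw [edist_dist]
    refine ENNReal.ofReal_le_of_le_toReal ?_
    by_contra! hlt
    have := prod_inter_pos_of_mem_support μ hRo hx.2 hy.2 (by simpa [hRdef] using hlt)
    exact this.ne' ((measureReal_eq_zero_iff).1 (hBi i))
  · by_contra! hlt
    have := prod_inter_pos_of_mem_support μ (isOpen_lt continuous_dist continuous_const) hx.2 hy.2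
      (show (x, y) ∈ {p : _ × _ | dist p.1 p.2 < 2} from hlt)
    refine this.ne' (measure_mono_null ?_ ((measureReal_eq_zero_iff).1 (hBc i j hij)))
    rintro p ⟨hp, hpB⟩
    exact ⟨hpB, fun hpR => lt_asymm (Set.mem_ofPred.1 hp) (Set.mem_ofPred.1 hpR)⟩
  · refine measure_mono_null ?_ (measure_iUnion_null hnull)
    rintro x (⟨hxA, hx⟩ | ⟨hx, hxA⟩)
    · obtain ⟨i, hi⟩ := Set.mem_iUnion.1 (hBu ▸ Set.mem_univ x)
      exact Set.mem_iUnion.2 ⟨i, ⟨hxA, hi⟩, fun hs => hx (Set.mem_iUnion.2 ⟨i, ⟨hxA, hi⟩, hs⟩)⟩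
    · obtain ⟨i, hi⟩ := Set.mem_iUnion.1 hx
      exact absurd hi.1.1 hxA
end

section
/- Let A ⊂ ℝ² be a measurable set such that no three points of A have all pairwise distances greater than 2. Then λ₂(A) ≤ 2π. -/
open MeasureTheory

section PlanarArea

open Set Metric
open scoped Real ENNReal ComplexConjugate

/-- The set of arguments of the points of `K` at distance `r` from the origin. -/
def circleArc (K : Set ℂ) (r : ℝ) : Set ℝ :=
  {θ | θ ∈ Ioo (-π) π ∧ Complex.polarCoord.symm (r, θ) ∈ K}

theorem measurable_complexPolarCoord_symm :
    Measurable fun p : ℝ × ℝ ↦ Complex.polarCoord.symm p := by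
  simp only [Complex.polarCoord_symm_apply]
  fun_prop

theorem measurable_volume_circleArc {K : Set ℂ} (hK : MeasurableSet K) :
    Measurable fun r ↦ volume (circleArc K r) := by
  have h : MeasurableSet {p : ℝ × ℝ | p.2 ∈ Ioo (-π) π ∧ Complex.polarCoord.symm p ∈ K} :=
    (measurable_snd measurableSet_Ioo).inter (measurable_complexPolarCoord_symm hK)
  exact measurable_measure_prodMk_left h

/-- The area of a planar set within an open annulus, in polar coordinates. -/
theorem volume_inter_annulus_eq_lintegral {K : Set ℂ} (hK : MeasurableSet K) {a b : ℝ}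
    (ha : 0 ≤ a) :
    volume (K ∩ {p | a < ‖p‖ ∧ ‖p‖ < b}) =
      ∫⁻ r in Ioo a b, ENNReal.ofReal r * volume (circleArc K r) := by
  have hann : MeasurableSet {p : ℂ | a < ‖p‖ ∧ ‖p‖ < b} :=
    (measurableSet_lt measurable_const measurable_norm).inter
      (measurableSet_lt measurable_norm measurable_const)
  have hE := hK.inter hann
  rw [← lintegral_indicator_one hE, ← Complex.lintegral_comp_polarCoord_symm]
  have htarget : polarCoord.target = Ioi (0 : ℝ) ×ˢ Ioo (-π) π := rfl
  rw [htarget, Measure.volume_eq_prod, setLIntegral_prod]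
  · rw [← lintegral_indicator measurableSet_Ioi, ← lintegral_indicator measurableSet_Ioo]
    congr 1
    ext r
    by_cases hr0 : 0 < r
    · rw [indicator_of_mem (show r ∈ Ioi (0 : ℝ) from hr0)]
      simp only [smul_eq_mul]
      rw [lintegral_const_mul]
      · by_cases hr : r ∈ Ioo a b
        · rw [indicator_of_mem hr, ← lintegral_indicator measurableSet_Ioo]
          congr 1
          have harc : MeasurableSet (circleArc K r) :=
            measurableSet_Ioo.inter
              ((measurable_complexPolarCoord_symm.comp measurable_prodMk_left) hK)
          rw [← lintegral_indicator_one harc]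
          congr 1
          ext θ
          have hn : ‖Complex.polarCoord.symm (r, θ)‖ = r := by
            rw [Complex.norm_polarCoord_symm, abs_of_pos hr0]
          by_cases h1 : θ ∈ Ioo (-π) π <;> by_cases h2 : Complex.polarCoord.symm (r, θ) ∈ K <;>
            simp only [indicator, circleArc, mem_inter_iff, mem_ofPred_eq, h1, h2, hn, hr.1, hr.2,
              and_true, if_true, if_false, and_false, Pi.one_apply]
        · rw [indicator_of_notMem hr]
          have : ∀ θ, (K ∩ {p : ℂ | a < ‖p‖ ∧ ‖p‖ < b}).indicator (1 : ℂ → ℝ≥0∞)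
              (Complex.polarCoord.symm (r, θ)) = 0 := by
            intro θ
            apply indicator_of_notMem
            rintro ⟨-, h⟩
            rw [mem_ofPred_eq, Complex.norm_polarCoord_symm, abs_of_pos hr0] at h
            exact hr h
          simp only [this, lintegral_zero, mul_zero]
      · exact (measurable_one.indicator hE).comp
          (measurable_complexPolarCoord_symm.comp measurable_prodMk_left)
    · rw [indicator_of_notMem (show r ∉ Ioi (0 : ℝ) from hr0),
        indicator_of_notMem (fun h : r ∈ Ioo a b ↦ hr0 (ha.trans_lt h.1))]
  · apply Measurable.aemeasurable
    simp only [smul_eq_mul]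
    exact (measurable_fst.ennreal_ofReal).mul
      ((measurable_one.indicator hE).comp measurable_complexPolarCoord_symm)

/-- The measure `r dr` on `(a, b)` is invariant under `r ↦ √(a² + b² - r²)`. -/
theorem lintegral_Ioo_sqrt_sub_sq {a b : ℝ} (ha : 0 ≤ a) (hab : a ≤ b) (g : ℝ → ℝ≥0∞) :
    ∫⁻ r in Ioo a b, ENNReal.ofReal r * g √(a ^ 2 + b ^ 2 - r ^ 2) =
      ∫⁻ r in Ioo a b, ENNReal.ofReal r * g r := by
  set f : ℝ → ℝ := fun r ↦ √(a ^ 2 + b ^ 2 - r ^ 2) with hf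
  have hmem : ∀ r ∈ Ioo a b, f r ∈ Ioo a b := by
    rintro r ⟨h1, h2⟩
    refine ⟨Real.lt_sqrt_of_sq_lt (by nlinarith), (Real.sqrt_lt' (by linarith)).2 (by nlinarith)⟩
  have hinv : ∀ r ∈ Ioo a b, f (f r) = r := by
    rintro r ⟨h1, h2⟩
    simp only [hf]
    rw [Real.sq_sqrt (by nlinarith), show a ^ 2 + b ^ 2 - (a ^ 2 + b ^ 2 - r ^ 2) = r ^ 2 by ring,
      Real.sqrt_sq (by linarith)]
  have himg : f '' Ioo a b = Ioo a b := by
    ext r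
    constructor
    · rintro ⟨s, hs, rfl⟩
      exact hmem s hs
    · exact fun hr ↦ ⟨f r, hmem r hr, hinv r hr⟩
  have hinj : InjOn f (Ioo a b) := fun r hr s hs h ↦ by
    rw [← hinv r hr, ← hinv s hs, h]
  have hderiv : ∀ r ∈ Ioo a b, HasDerivWithinAt f (-r / f r) (Ioo a b) r := by
    rintro r ⟨h1, h2⟩
    have hpos : 0 < a ^ 2 + b ^ 2 - r ^ 2 := by nlinarith
    have h := (((hasDerivAt_id r).pow 2).const_sub (a ^ 2 + b ^ 2)).sqrt
      (by simpa using hpos.ne')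
    refine (h.congr_deriv ?_).hasDerivWithinAt
    have : √(a ^ 2 + b ^ 2 - r ^ 2) ≠ 0 := (Real.sqrt_pos.2 hpos).ne'
    simp only [hf, id]
    simp
    field_simp
  have h := lintegral_image_eq_lintegral_abs_deriv_mul measurableSet_Ioo hderiv hinj
    (fun r ↦ ENNReal.ofReal r * g r)
  rw [himg] at h
  rw [h]
  refine setLIntegral_congr_fun measurableSet_Ioo fun r hr ↦ ?_
  have hfr : 0 < f r := ha.trans_lt (hmem r hr).1
  have hr0 : 0 < r := ha.trans_lt hr.1
  rw [← mul_assoc, ← ENNReal.ofReal_mul (abs_nonneg _), abs_div, abs_neg, abs_of_pos hr0,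
    abs_of_pos hfr, div_mul_cancel₀ _ hfr.ne']

theorem lintegral_Ioo_le_of_add_le {a b : ℝ} (ha : 0 ≤ a) (hab : a ≤ b) {g k : ℝ → ℝ≥0∞}
    (hg : Measurable g) (hk : Measurable k)
    (h : ∀ r ∈ Ioo a b, g r + g √(a ^ 2 + b ^ 2 - r ^ 2) ≤ k r + k √(a ^ 2 + b ^ 2 - r ^ 2)) :
    ∫⁻ r in Ioo a b, ENNReal.ofReal r * g r ≤ ∫⁻ r in Ioo a b, ENNReal.ofReal r * k r := by
  have key : ∀ g : ℝ → ℝ≥0∞, Measurable g → 2 * ∫⁻ r in Ioo a b, ENNReal.ofReal r * g r =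
      ∫⁻ r in Ioo a b, ENNReal.ofReal r * (g r + g √(a ^ 2 + b ^ 2 - r ^ 2)) := by
    intro g hg
    simp only [mul_add]
    rw [lintegral_add_left (by fun_prop), lintegral_Ioo_sqrt_sub_sq ha hab, two_mul]
  rw [← ENNReal.mul_le_mul_iff_right two_ne_zero ENNReal.ofNat_ne_top, key g hg, key k hk]
  exact setLIntegral_mono (by fun_prop) fun r hr ↦ mul_le_mul' le_rfl (h r hr)

theorem volume_add_volume_le_of_abs_sub_le {S T : Set ℝ} (hS : S.Nonempty) (hT : T.Nonempty)
    {d : ℝ} (h : ∀ s ∈ S, ∀ t ∈ T, |s - t| ≤ d) :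
    volume S + volume T ≤ ENNReal.ofReal (2 * d) := by
  obtain ⟨s₀, hs₀⟩ := hS
  obtain ⟨t₀, ht₀⟩ := hT
  have hSb : BddBelow S := ⟨t₀ - d, fun s hs ↦ by linarith [abs_le.1 (h s hs t₀ ht₀)]⟩
  have hSa : BddAbove S := ⟨t₀ + d, fun s hs ↦ by linarith [abs_le.1 (h s hs t₀ ht₀)]⟩
  have hTb : BddBelow T := ⟨s₀ - d, fun t ht ↦ by linarith [abs_le.1 (h s₀ hs₀ t ht)]⟩
  have hTa : BddAbove T := ⟨s₀ + d, fun t ht ↦ by linarith [abs_le.1 (h s₀ hs₀ t ht)]⟩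
  have hvol : ∀ U : Set ℝ, BddBelow U → BddAbove U →
      volume U ≤ ENNReal.ofReal (sSup U - sInf U) := fun U hb ha ↦
    (measure_mono (subset_Icc_csInf_csSup hb ha)).trans_eq Real.volume_Icc
  have h1 : sSup S ≤ sInf T + d := csSup_le ⟨s₀, hs₀⟩ fun s hs ↦ by
    have : s - d ≤ sInf T := le_csInf ⟨t₀, ht₀⟩ fun t ht ↦ by linarith [abs_le.1 (h s hs t ht)]
    linarith
  have h2 : sSup T ≤ sInf S + d := csSup_le ⟨t₀, ht₀⟩ fun t ht ↦ by
    have : t - d ≤ sInf S := le_csInf ⟨s₀, hs₀⟩ fun s hs ↦ by linarith [abs_le.1 (h s hs t ht)]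
    linarith
  have h3 : sInf S ≤ sSup S := (csInf_le hSb hs₀).trans (le_csSup hSa hs₀)
  have h4 : sInf T ≤ sSup T := (csInf_le hTb ht₀).trans (le_csSup hTa ht₀)
  refine (add_le_add (hvol S hSb hSa) (hvol T hTb hTa)).trans ?_
  rw [← ENNReal.ofReal_add (by linarith) (by linarith)]
  exact ENNReal.ofReal_le_ofReal (by linarith)

theorem sq_norm_polarCoord_symm_sub (r s θ η : ℝ) :
    ‖Complex.polarCoord.symm (r, θ) - Complex.polarCoord.symm (s, η)‖ ^ 2 =
      r ^ 2 + s ^ 2 - 2 * r * s * Real.cos (θ - η) := by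
  rw [Complex.sq_norm, Complex.normSq_apply, Real.cos_sub]
  simp only [Complex.polarCoord_symm_apply, Complex.sub_re, Complex.sub_im, Complex.mul_re,
    Complex.mul_im, Complex.add_re, Complex.add_im, Complex.ofReal_re, Complex.ofReal_im,
    Complex.I_re, Complex.I_im]
  linear_combination r ^ 2 * Real.sin_sq_add_cos_sq θ + s ^ 2 * Real.sin_sq_add_cos_sq η

/-- Half the angle under which the part at distance `r` from the origin of a unit disc centred at
distance `ρ` is seen from the origin. -/
noncomputable def halfAngle (ρ r : ℝ) : ℝ :=
  Real.arccos ((r ^ 2 + ρ ^ 2 - 1) / (2 * r * ρ))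

section HalfAngle

variable {ρ r s : ℝ}

theorem halfAngle_nonneg : 0 ≤ halfAngle ρ r := Real.arccos_nonneg _

theorem halfAngle_le_pi_div_two (hρ : 1 ≤ ρ) (hr : 0 < r) : halfAngle ρ r ≤ π / 2 :=
  Real.arccos_le_pi_div_two.2 (div_nonneg (by nlinarith) (by positivity))

theorem mul_cos_halfAngle (hρ : 1 ≤ ρ) (hr : 0 < r) (h : |r - ρ| ≤ 1) :
    2 * ρ * (r * Real.cos (halfAngle ρ r)) = r ^ 2 + ρ ^ 2 - 1 := by
  have h2 : 0 < 2 * r * ρ := by positivity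
  have h3 := abs_le.1 h
  rw [halfAngle, Real.cos_arccos]
  · field_simp
  · exact le_trans (by norm_num) (div_nonneg (by nlinarith) h2.le)
  · rw [div_le_one h2]
    nlinarith

theorem mul_cos_halfAngle_add (hρ : 1 ≤ ρ) (hr : 0 < r) (hs : 0 < s) (hrρ : |r - ρ| ≤ 1)
    (hsρ : |s - ρ| ≤ 1) (hrs : r ^ 2 + s ^ 2 = 2 * ρ ^ 2 + 2) :
    r * s * Real.cos (halfAngle ρ r + halfAngle ρ s) = ρ ^ 2 - 1 := by
  have h1 := mul_cos_halfAngle hρ hr hrρ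
  have h2 := mul_cos_halfAngle hρ hs hsρ
  have hρ0 : 0 < ρ := by linarith
  have h3 : s * Real.cos (halfAngle ρ s) = 2 * ρ - r * Real.cos (halfAngle ρ r) := by
    have : 2 * ρ * (s * Real.cos (halfAngle ρ s)) =
        2 * ρ * (2 * ρ - r * Real.cos (halfAngle ρ r)) := by linear_combination h2 + h1 + hrs
    exact mul_left_cancel₀ (by positivity) this
  have hsin : r * Real.sin (halfAngle ρ r) = s * Real.sin (halfAngle ρ s) := by
    have hp : ∀ t, 0 ≤ Real.sin (halfAngle ρ t) := fun t ↦
      Real.sin_nonneg_of_nonneg_of_le_pi halfAngle_nonneg (Real.arccos_le_pi _)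
    rw [← sq_eq_sq₀ (mul_nonneg hr.le (hp r)) (mul_nonneg hs.le (hp s)), mul_pow, mul_pow,
      Real.sin_sq, Real.sin_sq]
    have h4 : (s * Real.cos (halfAngle ρ s)) ^ 2 =
      (2 * ρ - r * Real.cos (halfAngle ρ r)) ^ 2 := by rw [h3]
    linear_combination h4 - hrs - 2 * h1
  rw [Real.cos_add]
  have h5 : (r * Real.sin (halfAngle ρ r)) * (s * Real.sin (halfAngle ρ s)) =
      r ^ 2 - (r * Real.cos (halfAngle ρ r)) ^ 2 := by
    rw [← hsin]
    linear_combination r ^ 2 * Real.sin_sq_add_cos_sq (halfAngle ρ r)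
  linear_combination (r * Real.cos (halfAngle ρ r)) * h3 - h5 + h1

theorem ofReal_two_mul_halfAngle_le (hρ : 1 ≤ ρ) (hr : 0 < r) (h : |r - ρ| ≤ 1) :
    ENNReal.ofReal (2 * halfAngle ρ r) ≤ volume (circleArc (closedBall (ρ : ℂ) 1) r) := by
  have hsub : Icc (-halfAngle ρ r) (halfAngle ρ r) ⊆ circleArc (closedBall (ρ : ℂ) 1) r := by
    intro θ hθ
    have hle := halfAngle_le_pi_div_two hρ hr
    have hπ := Real.pi_pos
    refine ⟨⟨by linarith [hθ.1], by linarith [hθ.2]⟩, ?_⟩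
    have hρ' : (ρ : ℂ) = Complex.polarCoord.symm (ρ, 0) := by simp
    rw [mem_closedBall, dist_eq_norm, ← sq_le_one_iff₀ (norm_nonneg _), hρ',
      sq_norm_polarCoord_symm_sub, sub_zero]
    have hcos : Real.cos (halfAngle ρ r) ≤ Real.cos θ := by
      rw [← Real.cos_abs θ]
      exact Real.cos_le_cos_of_nonneg_of_le_pi (abs_nonneg _) (by linarith) (abs_le.2 hθ)
    have h1 := mul_cos_halfAngle hρ hr h
    have h2 : 0 ≤ 2 * ρ * r * (Real.cos θ - Real.cos (halfAngle ρ r)) :=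
      mul_nonneg (by positivity) (by linarith)
    linarith
  refine le_trans (le_of_eq ?_) (measure_mono hsub)
  rw [Real.volume_Icc]
  congr 1
  ring

end HalfAngle

theorem mem_circleArc_norm_arg {K : Set ℂ} {p : ℂ} (hp : p ∈ K) (hre : 0 < p.re) :
    p.arg ∈ circleArc K ‖p‖ := by
  have h := abs_lt.1 (Complex.abs_arg_lt_pi_div_two_iff.2 (Or.inl hre))
  have hπ := Real.pi_pos
  refine ⟨⟨by linarith, by linarith⟩, ?_⟩
  rw [Complex.polarCoord_symm_apply]
  simpa using hp

theorem abs_lt_pi_div_two_of_mem_circleArc {K : Set ℂ} (hre : ∀ p ∈ K, 0 < p.re) {r θ : ℝ}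
    (hr : 0 < r) (hθ : θ ∈ circleArc K r) : |θ| < π / 2 := by
  have h := Complex.abs_arg_lt_pi_div_two_iff.2 (Or.inl (hre _ hθ.2))
  rw [Complex.polarCoord_symm_apply] at h
  have := Complex.arg_mul_cos_add_sin_mul_I hr (Ioo_subset_Ioc_self hθ.1)
  push_cast at h
  rwa [this] at h

/-- A planar set of diameter at most `2` that meets all circles about the origin with radius in
`(a, b)` has at most as much area in that annulus as a suitable unit disc. -/
theorem volume_inter_annulus_le {K : Set ℂ} (hK : MeasurableSet K) {a b ρ : ℝ}
    (ha : 0 < a) (hab : a ≤ b) (hba : b ≤ a + 2) (hρ : 1 ≤ ρ)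
    (hρab : a ^ 2 + b ^ 2 = 2 * ρ ^ 2 + 2) (hre : ∀ p ∈ K, 0 < p.re)
    (hdist : ∀ p ∈ K, ∀ q ∈ K, dist p q ≤ 2) (hne : ∀ r ∈ Ioo a b, ∃ p ∈ K, ‖p‖ = r) :
    volume (K ∩ {p | a < ‖p‖ ∧ ‖p‖ < b}) ≤
      volume (closedBall (ρ : ℂ) 1 ∩ {p | a < ‖p‖ ∧ ‖p‖ < b}) := by
  rw [volume_inter_annulus_eq_lintegral hK ha.le,
    volume_inter_annulus_eq_lintegral measurableSet_closedBall ha.le]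
  refine lintegral_Ioo_le_of_add_le ha.le hab (measurable_volume_circleArc hK)
    (measurable_volume_circleArc measurableSet_closedBall) fun r hr ↦ ?_
  have hrs : 0 ≤ a ^ 2 + b ^ 2 - r ^ 2 := by nlinarith [hr.1, hr.2]
  have hs : √(a ^ 2 + b ^ 2 - r ^ 2) ∈ Ioo a b :=
    ⟨Real.lt_sqrt_of_sq_lt (by nlinarith [hr.1, hr.2]),
      (Real.sqrt_lt' (by linarith)).2 (by nlinarith [hr.1, hr.2])⟩
  have hsq := Real.sq_sqrt hrs
  set s := √(a ^ 2 + b ^ 2 - r ^ 2)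
  have hrs2 : r ^ 2 + s ^ 2 = 2 * ρ ^ 2 + 2 := by linarith
  have hclose : ∀ t ∈ Ioo a b, 0 < t ∧ |t - ρ| ≤ 1 := fun t ht ↦ by
    have h1 : ρ ≤ a + 1 := by nlinarith
    have h2 : b ≤ ρ + 1 := by nlinarith
    exact ⟨ha.trans ht.1, abs_le.2 ⟨by linarith [ht.1], by linarith [ht.2]⟩⟩
  obtain ⟨hr0, hrρ⟩ := hclose r hr
  obtain ⟨hs0, hsρ⟩ := hclose s hs
  have hπ := Real.pi_pos
  have hnonempty : ∀ t ∈ Ioo a b, (circleArc K t).Nonempty := fun t ht ↦ by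
    obtain ⟨p, hp, rfl⟩ := hne t ht
    exact ⟨_, mem_circleArc_norm_arg hp (hre p hp)⟩
  refine (volume_add_volume_le_of_abs_sub_le (d := halfAngle ρ r + halfAngle ρ s)
    (hnonempty r hr) (hnonempty s hs) fun θ hθ η hη ↦ ?_).trans ?_
  · have hθ' := abs_lt.1 (abs_lt_pi_div_two_of_mem_circleArc hre hr0 hθ)
    have hη' := abs_lt.1 (abs_lt_pi_div_two_of_mem_circleArc hre hs0 hη)
    have hd : ‖Complex.polarCoord.symm (r, θ) - Complex.polarCoord.symm (s, η)‖ ≤ 2 := by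
      rw [← dist_eq_norm]
      exact hdist _ hθ.2 _ hη.2
    have hd2 := pow_le_pow_left₀ (norm_nonneg _) hd 2
    rw [sq_norm_polarCoord_symm_sub] at hd2
    have hcos := mul_cos_halfAngle_add hρ hr0 hs0 hrρ hsρ hrs2
    by_contra! hlt
    have hlt2 := Real.cos_lt_cos_of_nonneg_of_le_pi
      (add_nonneg halfAngle_nonneg halfAngle_nonneg)
      (abs_le.2 ⟨by linarith, by linarith⟩ : |θ - η| ≤ π) hlt
    rw [Real.cos_abs] at hlt2
    have := mul_lt_mul_of_pos_left hlt2 (mul_pos hr0 hs0)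
    linarith
  · rw [mul_add, ENNReal.ofReal_add (by linarith [@halfAngle_nonneg ρ r])
      (by linarith [@halfAngle_nonneg ρ s])]
    exact add_le_add (ofReal_two_mul_halfAngle_le hρ hr0 hrρ)
      (ofReal_two_mul_halfAngle_le hρ hs0 hsρ)

/-- The cap cut off from the closed unit disc by the half-plane `h ≤ re w`. -/
def unitCap (h : ℝ) : Set ℂ := {w | ‖w‖ ≤ 1 ∧ h ≤ w.re}

theorem measurableSet_unitCap (h : ℝ) : MeasurableSet (unitCap h) :=
  (measurableSet_le measurable_norm measurable_const).inter
    (measurableSet_le measurable_const Complex.measurable_re)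

theorem volume_re_eq (h : ℝ) : volume {w : ℂ | w.re = h} = 0 := by
  have : {w : ℂ | w.re = h} = Complex.measurableEquivRealProd ⁻¹' ({h} ×ˢ univ) := by
    ext w
    simp [Complex.measurableEquivRealProd]
  rw [this, Complex.volume_preserving_equiv_real_prod.measure_preimage_equiv,
    Measure.volume_eq_prod, Measure.prod_prod]
  simp

theorem measurePreserving_sub_conj (c : ℂ) : MeasurePreserving fun w : ℂ ↦ c - conj w :=
  (Measure.measurePreserving_sub_left volume c).comp Complex.conjLIE.measurePreserving

theorem sq_norm_ofReal_add (ρ : ℝ) (w : ℂ) :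
    ‖(ρ : ℂ) + w‖ ^ 2 = ρ ^ 2 + 2 * ρ * w.re + ‖w‖ ^ 2 := by
  rw [Complex.sq_norm, Complex.sq_norm, Complex.normSq_apply, Complex.normSq_apply]
  simp
  ring

theorem sq_norm_sub_conj (t : ℝ) (w : ℂ) :
    ‖2 * (t : ℂ) - conj w‖ ^ 2 = ‖w‖ ^ 2 + 4 * t ^ 2 - 4 * t * w.re := by
  rw [Complex.sq_norm, Complex.sq_norm, Complex.normSq_apply, Complex.normSq_apply]
  simp
  ring

/-- The two parts of a unit disc outside an annulus have at least the area of the two caps cut off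
by the chords through the intersection points of the boundaries. -/
theorem volume_closedBall_inter_annulus_add_le {a b ρ h : ℝ} (ha : 0 < a) (hb : 0 < b)
    (hρ : 0 < ρ) (hh : 0 ≤ h) (hah : a ^ 2 = ρ ^ 2 + 1 - 2 * ρ * h)
    (hbh : b ^ 2 = ρ ^ 2 + 1 + 2 * ρ * h) :
    volume (closedBall (ρ : ℂ) 1 ∩ {p | a < ‖p‖ ∧ ‖p‖ < b}) + 2 * volume (unitCap h) ≤
      ENNReal.ofReal π := by
  have hab : a ≤ b := by
    refine (sq_le_sq₀ ha.le hb.le).1 ?_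
    nlinarith [mul_nonneg hρ.le hh]
  set f : ℂ → ℝ := fun w ↦ ‖(ρ : ℂ) + w‖ with hf
  have hfm : Measurable f := by fun_prop
  have hfa : ∀ w, f w ≤ a ↔ ρ ^ 2 + 2 * ρ * w.re + ‖w‖ ^ 2 ≤ a ^ 2 := fun w ↦ by
    rw [← sq_norm_ofReal_add, sq_le_sq₀ (norm_nonneg _) ha.le]
  have hD : MeasurableSet {w : ℂ | ‖w‖ ≤ 1} := measurableSet_le measurable_norm measurable_const
  set T : Set ℂ := {w | ‖w‖ ≤ 1} ∩ {w | a < f w ∧ f w < b}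
  set I : Set ℂ := {w | ‖w‖ ≤ 1} ∩ {w | f w ≤ a}
  set O : Set ℂ := {w | ‖w‖ ≤ 1} ∩ {w | b ≤ f w}
  have hIm : MeasurableSet I := hD.inter (measurableSet_le hfm measurable_const)
  have hOm : MeasurableSet O := hD.inter (measurableSet_le measurable_const hfm)
  have hT : volume (closedBall (ρ : ℂ) 1 ∩ {p | a < ‖p‖ ∧ ‖p‖ < b}) = volume T := by
    rw [← measure_preimage_add volume (ρ : ℂ)]
    congr 1
    ext w
    simp [T, hf]
  have hsum : volume T + volume I + volume (O \ I) ≤ ENNReal.ofReal π := by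
    have hπ : volume {w : ℂ | ‖w‖ ≤ 1} = ENNReal.ofReal π := by
      have h1 := Complex.volume_closedBall 0 1
      simp only [closedBall, dist_zero_right] at h1
      rw [h1, ENNReal.ofReal_one, one_pow, one_mul, ENNReal.ofReal]
      congr 1
      ext
      simp [Real.pi_nonneg]
    rw [← hπ, ← measure_union _ hIm, ← measure_union _ (hOm.diff hIm)]
    · refine measure_mono ?_
      rintro w ((hw | hw) | hw)
      exacts [hw.1, hw.1, hw.1.1]
    · rw [disjoint_left]
      rintro w (hw | hw) hw'
      · exact not_le.2 hw.2.2 hw'.1.2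
      · exact hw'.2 hw
    · rw [disjoint_left]
      exact fun w hw hw' ↦ not_le.2 hw.2.1 hw'.2
  set J : Set ℂ := (fun w ↦ 0 - conj w) ⁻¹' I
  have hJ : volume J = volume I := (measurePreserving_sub_conj 0).measure_preimage
    hIm.nullMeasurableSet
  have hmemJ : ∀ w, ‖w‖ ^ 2 ≤ 1 → 2 * ρ * (h - w.re) ≤ 1 - ‖w‖ ^ 2 → w ∈ J := fun w h1 h2 ↦ by
    refine ⟨?_, (hfa _).2 ?_⟩
    · simpa using (sq_le_one_iff₀ (norm_nonneg _)).1 h1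
    · simp only [zero_sub, Complex.neg_re, Complex.conj_re, norm_neg, RCLike.norm_conj]
      linarith
  set R : Set ℂ := unitCap h \ (O \ I)
  have hRm : MeasurableSet R := (measurableSet_unitCap h).diff (hOm.diff hIm)
  have hR : volume ((fun w ↦ 2 * (h : ℂ) - conj w) ⁻¹' R) = volume R :=
    (measurePreserving_sub_conj _).measure_preimage hRm.nullMeasurableSet
  have hcapR : volume (unitCap h) + volume R ≤ volume I := by
    have hlt : volume (unitCap h) ≤ volume (unitCap h ∩ {w | h < w.re}) := by
      refine (measure_mono (t := unitCap h ∩ {w | h < w.re} ∪ {w | w.re = h}) fun w hw ↦ ?_).trans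
        ((measure_union_le _ _).trans (by rw [volume_re_eq, add_zero]))
      rcases hw.2.lt_or_eq with h1 | h1
      · exact Or.inl ⟨hw, h1⟩
      · exact Or.inr h1.symm
    rw [← hJ, ← hR]
    refine (add_le_add_left hlt _).trans ?_
    have hmem : ∀ w, 2 * (h : ℂ) - conj w ∈ R → w.re ≤ h ∧ w ∈ J := fun w hw ↦ by
      have h1 := hw.1.2
      have h2 := pow_le_pow_left₀ (norm_nonneg _) hw.1.1 2
      have h3 : f (2 * (h : ℂ) - conj w) ≤ b := by
        by_contra! h3
        exact hw.2 ⟨⟨hw.1.1, h3.le⟩, fun h4 ↦ by linarith [h4.2.out]⟩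
      rw [← sq_le_sq₀ (norm_nonneg _) hb.le, sq_norm_ofReal_add] at h3
      rw [sq_norm_sub_conj] at h2 h3
      simp only [Complex.sub_re, Complex.mul_re, Complex.conj_re, Complex.ofReal_re,
        Complex.ofReal_im, Complex.re_ofNat, Complex.im_ofNat, mul_zero, sub_zero] at h1 h3
      have h4 : w.re ≤ h := by linarith
      have h5 : 0 ≤ h * (h - w.re) := mul_nonneg hh (by linarith)
      exact ⟨h4, hmemJ w (by linarith) (by linarith)⟩
    rw [← measure_union]
    · refine measure_mono (union_subset (fun w hw ↦ ?_) fun w hw ↦ (hmem w hw).2)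
      have h1 := pow_le_one₀ (n := 2) (norm_nonneg w) hw.1.1
      exact hmemJ w h1 (by nlinarith [mul_nonneg hρ.le (sub_nonneg.2 hw.1.2)])
    · rw [disjoint_left]
      exact fun w hw hw' ↦ not_le.2 hw.2 (hmem w hw').1
    · exact (measurePreserving_sub_conj _).measurable hRm
  have hsplit : volume (unitCap h) ≤ volume (O \ I) + volume R := by
    refine (measure_mono fun w hw ↦ ?_).trans (measure_union_le _ _)
    by_cases h1 : w ∈ O \ I
    exacts [Or.inl h1, Or.inr ⟨hw, h1⟩]
  rw [hT]
  refine le_trans ?_ hsum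
  calc volume T + 2 * volume (unitCap h)
      = volume T + (volume (unitCap h) + volume (unitCap h)) := by rw [two_mul]
    _ ≤ volume T + (volume (unitCap h) + (volume (O \ I) + volume R)) := by gcongr
    _ = volume T + (volume (unitCap h) + volume R) + volume (O \ I) := by ring
    _ ≤ volume T + volume I + volume (O \ I) := by gcongr

theorem volume_cap_le {D h : ℝ} (hD : 2 ≤ D) (hh : h ≤ 7 / 16 * D - 3 / 4) :
    volume {p : ℂ | ‖p‖ ≤ 2 ∧ D / 2 ≤ p.re} ≤ 2 * volume (unitCap h) := by
  have he := Complex.volume_preserving_equiv_real_prod.symm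
  rw [← he.measure_preimage_equiv, ← he.measure_preimage_equiv (unitCap h),
    ← measure_preimage_add_right volume ((-3 / 4, 0) : ℝ × ℝ)
      (Complex.measurableEquivRealProd.symm ⁻¹' unitCap h)]
  set L : ℝ × ℝ →ₗ[ℝ] ℝ × ℝ :=
    LinearMap.prodMap ((7 / 8 : ℝ) • LinearMap.id) ((4 / 7 : ℝ) • LinearMap.id) with hL
  have hdet : LinearMap.det L = 1 / 2 := by
    rw [hL, LinearMap.det_prodMap, LinearMap.det_smul, LinearMap.det_smul]
    norm_num
  have h2 : (2 : ℝ≥0∞) = ENNReal.ofReal |(LinearMap.det L)⁻¹| := by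
    rw [hdet]
    norm_num
  rw [h2, ← Measure.addHaar_preimage_linearMap volume (by rw [hdet]; norm_num)]
  refine measure_mono ?_
  rintro ⟨t, v⟩ ⟨h1, h3⟩
  have hn : ∀ t v : ℝ, ‖Complex.measurableEquivRealProd.symm (t, v)‖ ^ 2 = t ^ 2 + v ^ 2 := by
    intro t v
    rw [Complex.sq_norm, Complex.normSq_apply]
    simp [Complex.measurableEquivRealProd]
    ring
  have h1' := pow_le_pow_left₀ (norm_nonneg _) h1 2
  rw [hn] at h1'
  have h3' : D / 2 ≤ t := h3
  have h4 : t ≤ 2 := by nlinarith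
  refine ⟨?_, ?_⟩
  · rw [← sq_le_one_iff₀ (norm_nonneg _)]
    change ‖Complex.measurableEquivRealProd.symm (7 / 8 * t + -3 / 4, 4 / 7 * v + 0)‖ ^ 2 ≤ 1
    rw [hn]
    nlinarith
  · change h ≤ 7 / 8 * t + -3 / 4
    linarith

theorem closure_convexHull_subset {S C : Set ℂ} (hS : S ⊆ C) (hC : Convex ℝ C)
    (hC' : IsClosed C) : closure (convexHull ℝ S) ⊆ C :=
  closure_minimal (convexHull_min hS hC) hC'

theorem dist_le_of_mem_closure_convexHull {S : Set ℂ} {d : ℝ}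
    (hS : ∀ p ∈ S, ∀ q ∈ S, dist p q ≤ d) :
    ∀ p ∈ closure (convexHull ℝ S), ∀ q ∈ closure (convexHull ℝ S), dist p q ≤ d := by
  have h : ∀ q ∈ S, closure (convexHull ℝ S) ⊆ closedBall q d := fun q hq ↦
    closure_convexHull_subset (fun p hp ↦ hS p hp q hq) (convex_closedBall q d) isClosed_closedBall
  intro p hp q hq
  exact closure_convexHull_subset (fun q hq ↦ mem_closedBall'.2 (h q hq hp))
    (convex_closedBall p d) isClosed_closedBall hq |> mem_closedBall'.1

theorem exists_norm_eq_of_convex {K : Set ℂ} (hK : Convex ℝ K) {p q : ℂ} (hp : p ∈ K)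
    (hq : q ∈ K) {r : ℝ} (hpr : ‖p‖ ≤ r) (hrq : r ≤ ‖q‖) : ∃ w ∈ K, ‖w‖ = r :=
  hK.isPreconnected.intermediate_value hp hq continuous_norm.continuousOn ⟨hpr, hrq⟩

theorem volume_inter_annulus_add_unitCap_le {K : Set ℂ} (hK : MeasurableSet K) {a b ρ h : ℝ}
    (ha : 0 < a) (hab : a ≤ b) (hba : b ≤ a + 2) (hρ : 1 ≤ ρ) (hh : 0 ≤ h)
    (hah : a ^ 2 = ρ ^ 2 + 1 - 2 * ρ * h) (hbh : b ^ 2 = ρ ^ 2 + 1 + 2 * ρ * h)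
    (hre : ∀ p ∈ K, 0 < p.re) (hdist : ∀ p ∈ K, ∀ q ∈ K, dist p q ≤ 2)
    (hne : ∀ r ∈ Ioo a b, ∃ p ∈ K, ‖p‖ = r) :
    volume (K ∩ {p | a ≤ ‖p‖ ∧ ‖p‖ ≤ b}) + 2 * volume (unitCap h) ≤ ENNReal.ofReal π := by
  refine le_trans ?_
    (volume_closedBall_inter_annulus_add_le ha (ha.trans_le hab) (by linarith) hh hah hbh)
  gcongr ?_ + _
  refine le_trans ?_ (volume_inter_annulus_le hK ha hab hba hρ (by linarith) hre hdist hne)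
  have hsub : K ∩ {p | a ≤ ‖p‖ ∧ ‖p‖ ≤ b} ⊆
      K ∩ {p | a < ‖p‖ ∧ ‖p‖ < b} ∪ (sphere 0 a ∪ sphere 0 b) := by
    rintro p ⟨hp, h1, h2⟩
    rcases h1.lt_or_eq with h1 | h1
    · rcases h2.lt_or_eq with h2 | h2
      · exact Or.inl ⟨hp, h1, h2⟩
      · exact Or.inr (Or.inr (mem_sphere_zero_iff_norm.2 h2))
    · exact Or.inr (Or.inl (mem_sphere_zero_iff_norm.2 h1.symm))
  refine (measure_mono hsub).trans ((measure_union_le _ _).trans ?_)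
  rw [measure_union_null (Measure.addHaar_sphere _ _ _) (Measure.addHaar_sphere _ _ _), add_zero]

/-- The isodiametric inequality for planar sets of diameter at most `2`. -/
theorem volume_le_pi_of_dist_le_two {S : Set ℂ} (hS : ∀ p ∈ S, ∀ q ∈ S, dist p q ≤ 2) :
    volume S ≤ ENNReal.ofReal π := by
  obtain rfl | ⟨c, hc⟩ := S.eq_empty_or_nonempty
  · simp
  rw [← measure_preimage_add_right volume (c - 10)]
  set S' := (· + (c - 10)) ⁻¹' S
  have hS' : ∀ p ∈ S', ∀ q ∈ S', dist p q ≤ 2 := fun p hp q hq ↦ by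
    simpa using hS _ hp _ hq
  have h10 : (10 : ℂ) ∈ S' := by simpa [S'] using hc
  have hdist := dist_le_of_mem_closure_convexHull hS'
  have hconv : Convex ℝ (closure (convexHull ℝ S')) := (convex_convexHull ℝ S').closure
  have hsub : S' ⊆ closure (convexHull ℝ S') := (subset_convexHull ℝ S').trans subset_closure
  have hmeas : MeasurableSet (closure (convexHull ℝ S')) := isClosed_closure.measurableSet
  set K := closure (convexHull ℝ S')
  have hnear : ∀ p ∈ K, ∀ q ∈ K, ‖p‖ ≤ ‖q‖ + 2 := fun p hp q hq ↦ by
    have := norm_sub_norm_le p q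
    linarith [hdist p hp q hq, dist_eq_norm p q]
  have hn10 : ‖(10 : ℂ)‖ = 10 := by simp
  have hne : (norm '' K).Nonempty := ⟨_, mem_image_of_mem _ (hsub h10)⟩
  have hbelow : BddBelow (norm '' K) := ⟨0, forall_mem_image.2 fun p _ ↦ norm_nonneg p⟩
  have habove : BddAbove (norm '' K) :=
    ⟨12, forall_mem_image.2 fun p hp ↦ by linarith [hnear p hp _ (hsub h10)]⟩
  set a := sInf (norm '' K)
  set b := sSup (norm '' K)
  have ha : ∀ p ∈ K, a ≤ ‖p‖ := fun p hp ↦ csInf_le hbelow (mem_image_of_mem _ hp)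
  have hb : ∀ p ∈ K, ‖p‖ ≤ b := fun p hp ↦ le_csSup habove (mem_image_of_mem _ hp)
  have ha8 : 8 ≤ a := le_csInf hne <| forall_mem_image.2 fun p hp ↦ by
    linarith [hnear _ (hsub h10) p hp]
  have hab : a ≤ b := (ha _ (hsub h10)).trans (hb _ (hsub h10))
  have hba : b ≤ a + 2 := csSup_le hne <| forall_mem_image.2 fun p hp ↦ by
    have : ‖p‖ - 2 ≤ a := le_csInf hne <| forall_mem_image.2 fun q hq ↦ by
      linarith [hnear p hp q hq]
    linarith
  have hre : ∀ p ∈ K, 0 < p.re := fun p hp ↦ by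
    have h1 := (Complex.abs_re_le_norm (p - 10)).trans
      ((dist_eq_norm p 10).symm.le.trans (hdist p hp _ (hsub h10)))
    have h2 := (abs_le.1 h1).1
    simp only [Complex.sub_re, Complex.re_ofNat] at h2
    linarith
  have hρ : 1 ≤ √((a ^ 2 + b ^ 2) / 2 - 1) := Real.le_sqrt_of_sq_le (by nlinarith)
  have hρ2 : √((a ^ 2 + b ^ 2) / 2 - 1) ^ 2 = (a ^ 2 + b ^ 2) / 2 - 1 :=
    Real.sq_sqrt (by nlinarith)
  set ρ := √((a ^ 2 + b ^ 2) / 2 - 1)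
  have hρh : 2 * ρ * ((b ^ 2 - a ^ 2) / (4 * ρ)) = (b ^ 2 - a ^ 2) / 2 := by
    field_simp
    ring
  have hSK : volume S' ≤ volume (K ∩ {p | a ≤ ‖p‖ ∧ ‖p‖ ≤ b}) :=
    measure_mono fun p hp ↦ ⟨hsub hp, ha p (hsub hp), hb p (hsub hp)⟩
  refine hSK.trans
    (le_self_add.trans (volume_inter_annulus_add_unitCap_le hmeas (h := (b ^ 2 - a ^ 2) / (4 * ρ))
    (by linarith) hab hba hρ
    (div_nonneg (by nlinarith) (by linarith)) (by linarith) (by linarith) hre hdist ?_))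
  rintro r ⟨hr1, hr2⟩
  obtain ⟨-, ⟨p, hp, rfl⟩, hpr⟩ := exists_lt_of_csInf_lt hne hr1
  obtain ⟨-, ⟨q, hq, rfl⟩, hrq⟩ := exists_lt_of_lt_csSup hne hr2
  exact exists_norm_eq_of_convex hconv hp hq hpr.le hrq.le

/-- A sharpening of the isodiametric inequality for sets with points at distance `D > 2` from the
origin but no points at distance at most `2` or more than `D` from the origin. -/
theorem volume_add_unitCap_le {S : Set ℂ} {D : ℝ} (hD : 2 < D) (hD4 : D ≤ 4)
    (hS : ∀ p ∈ S, ∀ q ∈ S, dist p q ≤ 2) (hDS : (D : ℂ) ∈ S) (hS2 : ∀ p ∈ S, 2 < ‖p‖)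
    (hSD : ∀ p ∈ S, ‖p‖ ≤ D) :
    volume S + 2 * volume (unitCap (7 / 16 * D - 3 / 4)) ≤ ENNReal.ofReal π := by
  have hdist := dist_le_of_mem_closure_convexHull hS
  have hconv : Convex ℝ (closure (convexHull ℝ S)) := (convex_convexHull ℝ S).closure
  have hsub : S ⊆ closure (convexHull ℝ S) := (subset_convexHull ℝ S).trans subset_closure
  have hmeas : MeasurableSet (closure (convexHull ℝ S)) := isClosed_closure.measurableSet
  have hre : ∀ p ∈ closure (convexHull ℝ S), 0 < p.re := by
    have : closure (convexHull ℝ S) ⊆ {p | D / 2 ≤ p.re} := by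
      refine closure_convexHull_subset (fun p hp ↦ ?_) (convex_halfSpace_re_ge _)
        (isClosed_le continuous_const Complex.continuous_re)
      have h1 := pow_le_pow_left₀ dist_nonneg (hS p hp D hDS) 2
      have h2 := hS2 p hp
      rw [dist_eq_norm, sub_eq_neg_add, ← Complex.ofReal_neg, sq_norm_ofReal_add] at h1
      rw [mem_ofPred_eq]
      nlinarith
    exact fun p hp ↦ (by linarith : 0 < D / 2).trans_le (this hp)
  set K := closure (convexHull ℝ S)
  have hnD : ‖(D : ℂ)‖ = D := by simp [abs_of_pos (two_pos.trans hD)]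
  have hne : (norm '' K).Nonempty := ⟨_, mem_image_of_mem _ (hsub hDS)⟩
  have hbelow : BddBelow (norm '' K) := ⟨0, forall_mem_image.2 fun p _ ↦ norm_nonneg p⟩
  set i := sInf (norm '' K)
  have hi : ∀ p ∈ K, i ≤ ‖p‖ := fun p hp ↦ csInf_le hbelow (mem_image_of_mem _ hp)
  have hiD : D - 2 ≤ i := le_csInf hne <| forall_mem_image.2 fun p hp ↦ by
    have := norm_sub_norm_le (D : ℂ) p
    linarith [hdist _ (hsub hDS) p hp, dist_eq_norm (D : ℂ) p]
  obtain ⟨a, ha⟩ : ∃ a, a = max 2 i := ⟨_, rfl⟩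
  have ha2 : 2 ≤ a := ha ▸ le_max_left _ _
  have hia : i ≤ a := ha ▸ le_max_right _ _
  have haD : a ≤ D := ha ▸ max_le hD.le ((hi _ (hsub hDS)).trans_eq hnD)
  have hρ : 1 ≤ √((a ^ 2 + D ^ 2) / 2 - 1) := Real.le_sqrt_of_sq_le (by nlinarith)
  have hρ2 : √((a ^ 2 + D ^ 2) / 2 - 1) ^ 2 = (a ^ 2 + D ^ 2) / 2 - 1 :=
    Real.sq_sqrt (by nlinarith)
  set ρ := √((a ^ 2 + D ^ 2) / 2 - 1)
  have hρh : 2 * ρ * ((D ^ 2 - a ^ 2) / (4 * ρ)) = (D ^ 2 - a ^ 2) / 2 := by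
    field_simp
    ring
  have hh : (D ^ 2 - a ^ 2) / (4 * ρ) ≤ 7 / 16 * D - 3 / 4 := by
    have h1 : D ^ 2 - 4 ≤ (7 / 4 * D - 3) * ρ := by
      refine le_of_sq_le_sq ?_ (mul_nonneg (by linarith) (by linarith))
      rw [mul_pow, hρ2]
      have h2 : (D ^ 2 - 4) ^ 2 ≤ (7 / 4 * D - 3) ^ 2 * (D ^ 2 / 2 + 1) := by
        have h3 : 17 * D ^ 3 - 100 * D ^ 2 + 98 * D + 56 ≤ 0 := by
          nlinarith [mul_nonneg (sub_nonneg.2 hD.le) (sub_nonneg.2 hD4),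
            mul_nonneg (mul_nonneg (sub_nonneg.2 hD.le) (sub_nonneg.2 hD4)) (by linarith : 0 ≤ D)]
        nlinarith [mul_nonneg (sub_nonneg.2 hD4) (neg_nonneg.2 h3)]
      nlinarith [mul_nonneg (sq_nonneg (7 / 4 * D - 3)) (by nlinarith : 0 ≤ a ^ 2 - 4)]
    rw [div_le_iff₀ (by linarith)]
    nlinarith
  have hcap : volume (unitCap (7 / 16 * D - 3 / 4)) ≤
      volume (unitCap ((D ^ 2 - a ^ 2) / (4 * ρ))) :=
    measure_mono fun w hw ↦ ⟨hw.1, hh.trans hw.2⟩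
  have hSK : volume S ≤ volume (K ∩ {p | a ≤ ‖p‖ ∧ ‖p‖ ≤ D}) :=
    measure_mono fun p hp ↦
      ⟨hsub hp, ha ▸ max_le (hS2 p hp).le (hi p (hsub hp)), hSD p hp⟩
  refine (add_le_add hSK (mul_le_mul' le_rfl hcap)).trans
    (volume_inter_annulus_add_unitCap_le hmeas (by linarith) haD (by linarith) hρ
    (div_nonneg (by nlinarith) (by linarith)) (by linarith) (by linarith) hre hdist ?_)
  rintro r ⟨hr1, hr2⟩
  obtain ⟨-, ⟨p, hp, rfl⟩, hpr⟩ := exists_lt_of_csInf_lt hne (hia.trans_lt hr1)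
  exact exists_norm_eq_of_convex hconv hp (hsub hDS) hpr.le (hr2.le.trans_eq hnD.symm)

/-- The lens of two discs of radius `2` has at most the area of four suitable caps of the unit
disc. -/
theorem volume_closedBall_inter_closedBall_le {D h : ℝ} (hD : 2 ≤ D)
    (hh : h ≤ 7 / 16 * D - 3 / 4) :
    volume (closedBall (0 : ℂ) 2 ∩ closedBall (D : ℂ) 2) ≤ 4 * volume (unitCap h) := by
  set C : Set ℂ := {p | ‖p‖ ≤ 2 ∧ D / 2 ≤ p.re}
  have hC : MeasurableSet C := (measurableSet_le measurable_norm measurable_const).inter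
    (measurableSet_le measurable_const Complex.measurable_re)
  have hsub : closedBall (0 : ℂ) 2 ∩ closedBall (D : ℂ) 2 ⊆
      C ∪ (fun w ↦ (D : ℂ) - conj w) ⁻¹' C := by
    rintro p ⟨h1, h2⟩
    rw [mem_closedBall_zero_iff] at h1
    rw [mem_closedBall', dist_eq_norm] at h2
    rcases le_total (D / 2) p.re with h3 | h3
    · exact Or.inl ⟨h1, h3⟩
    · refine Or.inr ⟨?_, ?_⟩
      · rw [← RCLike.norm_conj]
        simpa using h2
      · simp only [Complex.sub_re, Complex.ofReal_re, Complex.conj_re]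
        linarith
  refine (measure_mono hsub).trans ((measure_union_le _ _).trans ?_)
  rw [(measurePreserving_sub_conj (D : ℂ)).measure_preimage hC.nullMeasurableSet, ← two_mul]
  refine (mul_le_mul' le_rfl (volume_cap_le hD hh)).trans_eq ?_
  rw [← mul_assoc]
  norm_num

theorem two_mul_volume_add_volume_le {A : Set ℂ} (hA : MeasurableSet A) {x y : ℂ} (hy : y ∈ A)
    (hxy : 2 < dist x y) (hxy4 : dist x y ≤ 4)
    (hmax : ∀ p ∈ A, dist x p ≤ dist x y)
    (hfar : ∀ p ∈ A, ∀ q ∈ A, 2 < dist x p → 2 < dist x q → dist p q ≤ 2) :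
    2 * volume (A \ closedBall x 2) + volume (A ∩ (closedBall x 2 ∩ closedBall y 2)) ≤
      ENNReal.ofReal (2 * π) := by
  set D := dist x y with hD
  have hD0 : (D : ℂ) ≠ 0 := Complex.ofReal_ne_zero.2 (by linarith)
  obtain ⟨u, hu⟩ : ∃ u : Circle, (u : ℂ) = (y - x) / D := by
    refine ⟨⟨(y - x) / D, mem_sphere_zero_iff_norm.2 ?_⟩, rfl⟩
    rw [norm_div, Complex.norm_real, ← dist_eq_norm, dist_comm, ← hD,
      Real.norm_of_nonneg dist_nonneg, div_self (by linarith)]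
  set ψ : ℂ → ℂ := fun w ↦ x + rotation u w with hψ
  have hψm : MeasurePreserving ψ :=
    (measurePreserving_add_left volume x).comp (rotation u).measurePreserving
  have hψd : ∀ v w, dist (ψ v) (ψ w) = dist v w := fun v w ↦ by
    simp only [hψ, dist_add_left, LinearIsometryEquiv.dist_map]
  have hψ0 : ψ 0 = x := by simp [hψ]
  have hψD : ψ D = y := by
    simp only [hψ]
    rw [rotation_apply, hu, div_mul_cancel₀ _ hD0, add_sub_cancel]
  have hψx : ∀ w, dist x (ψ w) = ‖w‖ := fun w ↦ by
    rw [← hψ0, hψd, dist_zero_left]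
  have hS := volume_add_unitCap_le (S := ψ ⁻¹' (A \ closedBall x 2)) hxy hxy4
    (fun p hp q hq ↦ by
      rw [← hψd]
      exact hfar _ hp.1 _ hq.1 (not_le.1 (mem_closedBall'.not.1 hp.2))
        (not_le.1 (mem_closedBall'.not.1 hq.2)))
    (by
      rw [mem_preimage, hψD]
      exact ⟨hy, fun h ↦ hxy.not_ge (mem_closedBall'.1 h)⟩)
    (fun p hp ↦ by
      rw [← hψx]
      exact not_le.1 (mem_closedBall'.not.1 hp.2))
    (fun p hp ↦ by
      rw [← hψx]
      exact hmax _ hp.1)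
  rw [hψm.measure_preimage (hA.diff measurableSet_closedBall).nullMeasurableSet] at hS
  have hM : volume (closedBall x 2 ∩ closedBall y 2) ≤
      4 * volume (unitCap (7 / 16 * D - 3 / 4)) := by
    refine le_trans (le_of_eq ?_) (volume_closedBall_inter_closedBall_le hxy.le le_rfl)
    rw [← hψm.measure_preimage
      (measurableSet_closedBall.inter measurableSet_closedBall).nullMeasurableSet]
    congr 1
    ext w
    simp only [mem_preimage, mem_inter_iff, mem_closedBall]
    rw [← hψ0, ← hψD, hψd, hψd]
  calc 2 * volume (A \ closedBall x 2) + volume (A ∩ (closedBall x 2 ∩ closedBall y 2))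
      ≤ 2 * volume (A \ closedBall x 2) + 4 * volume (unitCap (7 / 16 * D - 3 / 4)) := by
        gcongr
        exact (measure_mono inter_subset_right).trans hM
    _ = 2 * (volume (A \ closedBall x 2) + 2 * volume (unitCap (7 / 16 * D - 3 / 4))) := by ring
    _ ≤ 2 * ENNReal.ofReal π := by gcongr
    _ = ENNReal.ofReal (2 * π) := by rw [ENNReal.ofReal_mul two_pos.le, ENNReal.ofReal_ofNat]

theorem volume_le_of_isMaxOn_dist {A : Set ℂ} (hA : MeasurableSet A)
    (hfree : ∀ x ∈ A, ∀ y ∈ A, ∀ z ∈ A, dist x y ≤ 2 ∨ dist x z ≤ 2 ∨ dist y z ≤ 2)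
    {x y : ℂ} (hx : x ∈ A) (hy : y ∈ A) (hxy : 2 < dist x y)
    (hmax : ∀ p ∈ A, ∀ q ∈ A, dist p q ≤ dist x y) :
    volume A ≤ ENNReal.ofReal (2 * π) := by
  have hfar : ∀ x ∈ A, ∀ p ∈ A, ∀ q ∈ A, 2 < dist x p → 2 < dist x q → dist p q ≤ 2 :=
    fun x hx p hp q hq h1 h2 ↦
      ((hfree x hx p hp q hq).resolve_left h1.not_ge).resolve_left h2.not_ge
  have hsub : A ⊆ A \ closedBall x 2 ∪ A \ closedBall y 2 ∪
      A ∩ (closedBall x 2 ∩ closedBall y 2) := fun p hp ↦ by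
    simp only [mem_union, mem_sdiff, mem_inter_iff]
    tauto
  have hle := (measure_mono (μ := volume) hsub).trans
    ((measure_union_le _ _).trans (add_le_add_left (measure_union_le _ _) _))
  rcases le_or_gt (dist x y) 4 with h4 | h4
  · have h1 := two_mul_volume_add_volume_le hA hy hxy h4 (hmax x hx) (hfar x hx)
    have h2 := two_mul_volume_add_volume_le hA hx (dist_comm x y ▸ hxy) (dist_comm x y ▸ h4)
      (dist_comm x y ▸ hmax y hy) (hfar y hy)
    rw [inter_comm (closedBall y 2)] at h2
    rw [← ENNReal.mul_le_mul_iff_right two_ne_zero ENNReal.ofNat_ne_top]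
    refine (mul_le_mul' le_rfl hle).trans (le_trans (le_of_eq ?_) ((add_le_add h1 h2).trans_eq ?_))
    · ring
    · exact (two_mul _).symm
  · have hπ : ∀ z ∈ A, volume (A \ closedBall z 2) ≤ ENNReal.ofReal π := fun z hz ↦
      volume_le_pi_of_dist_le_two fun p hp q hq ↦ hfar z hz p hp.1 q hq.1
        (not_le.1 (mem_closedBall'.not.1 hp.2)) (not_le.1 (mem_closedBall'.not.1 hq.2))
    have hempty : closedBall x 2 ∩ closedBall y 2 = ∅ :=
      (closedBall_disjoint_closedBall (by linarith)).inter_eq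
    rw [hempty, inter_empty, measure_empty, add_zero] at hle
    refine (hle.trans (add_le_add (hπ x hx) (hπ y hy))).trans_eq ?_
    rw [← ENNReal.ofReal_add Real.pi_nonneg Real.pi_nonneg, two_mul]

/-- A planar set without three points at pairwise distances greater than `2` has area at most
`2 * π`. -/
theorem volume_le_two_mul_pi {A : Set ℂ}
    (hfree : ∀ x ∈ A, ∀ y ∈ A, ∀ z ∈ A, dist x y ≤ 2 ∨ dist x z ≤ 2 ∨ dist y z ≤ 2) :
    volume A ≤ ENNReal.ofReal (2 * π) := by
  by_cases hpair : ∀ p ∈ A, ∀ q ∈ A, dist p q ≤ 2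
  · exact (volume_le_pi_of_dist_le_two hpair).trans
      (ENNReal.ofReal_le_ofReal (by linarith [Real.pi_pos]))
  push Not at hpair
  obtain ⟨x, hx, y, hy, hxy⟩ := hpair
  have hbdd : Bornology.IsBounded A := by
    refine (isBounded_closedBall (x := x) (r := dist x y + 2)).subset fun p hp ↦ ?_
    rw [mem_closedBall']
    rcases hfree x hx y hy p hp with h | h | h
    · exact absurd h hxy.not_ge
    · linarith
    · linarith [dist_triangle x y p]
  have hfree' : ∀ x ∈ closure A, ∀ y ∈ closure A, ∀ z ∈ closure A,
      dist x y ≤ 2 ∨ dist x z ≤ 2 ∨ dist y z ≤ 2 := by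
    have hclosed : IsClosed ({t : ℂ × ℂ × ℂ | dist t.1 t.2.1 ≤ 2} ∪
        ({t | dist t.1 t.2.2 ≤ 2} ∪ {t | dist t.2.1 t.2.2 ≤ 2})) :=
      (isClosed_le (by fun_prop) continuous_const).union
        ((isClosed_le (by fun_prop) continuous_const).union
          (isClosed_le (by fun_prop) continuous_const))
    intro x hx y hy z hz
    have hmem : (x, y, z) ∈ closure (A ×ˢ A ×ˢ A) := by
      rw [closure_prod_eq, closure_prod_eq]
      exact ⟨hx, hy, hz⟩
    exact closure_minimal (fun t ht ↦ hfree _ ht.1 _ ht.2.1 _ ht.2.2) hclosed hmem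
  have hcomp := hbdd.isCompact_closure
  obtain ⟨⟨x', y'⟩, ⟨hx', hy'⟩, hmax⟩ := (hcomp.prod hcomp).exists_isMaxOn
    ⟨(x, y), subset_closure hx, subset_closure hy⟩ continuous_dist.continuousOn
  have hmax' : ∀ p ∈ closure A, ∀ q ∈ closure A, dist p q ≤ dist x' y' :=
    fun p hp q hq ↦ hmax (mk_mem_prod hp hq)
  exact (measure_mono subset_closure).trans (volume_le_of_isMaxOn_dist
    isClosed_closure.measurableSet hfree' hx' hy'
    (hxy.trans_le (hmax' x (subset_closure hx) y (subset_closure hy))) hmax')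

end PlanarArea

theorem stmt3 (A : Set (EuclideanSpace ℝ (Fin 2))) (hA : MeasurableSet A)
    (hfree : ¬ ∃ x y z, x ∈ A ∧ y ∈ A ∧ z ∈ A ∧
      2 < dist x y ∧ 2 < dist x z ∧ 2 < dist y z) :
    volume A ≤ ENNReal.ofReal (2 * Real.pi) := by
  have he := Complex.orthonormalBasisOneI.measurePreserving_repr
  rw [← he.measure_preimage hA.nullMeasurableSet]
  refine volume_le_two_mul_pi fun x hx y hy z hz ↦ ?_
  by_contra! h
  exact hfree ⟨_, _, _, hx, hy, hz, by simpa only [LinearIsometryEquiv.dist_map] using h⟩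
end

section
/- Let A ⊂ ℝ² be a measurable set such that no three points of A have all pairwise distances greater than 2. Then (1/2)·λ₄({(p,q) ∈ A×A : ‖p−q‖ > 2}) ≤ π². -/
open MeasureTheory

lemma volume_add_volume_le_of_abs_sub_le_s4 {U V : Set ℝ} (hU : U.Nonempty) (hV : V.Nonempty)
    {r : ℝ} (h : ∀ u ∈ U, ∀ v ∈ V, |u - v| ≤ r) :
    volume U + volume V ≤ ENNReal.ofReal (2 * r) := by
  obtain ⟨u₀, hu₀⟩ := hU
  obtain ⟨v₀, hv₀⟩ := hV
  have hUa : BddAbove U := ⟨v₀ + r, fun u hu => by linarith [(abs_le.1 (h u hu v₀ hv₀)).2]⟩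
  have hUb : BddBelow U := ⟨v₀ - r, fun u hu => by linarith [(abs_le.1 (h u hu v₀ hv₀)).1]⟩
  have hVa : BddAbove V := ⟨u₀ + r, fun v hv => by linarith [(abs_le.1 (h u₀ hu₀ v hv)).1]⟩
  have hVb : BddBelow V := ⟨u₀ - r, fun v hv => by linarith [(abs_le.1 (h u₀ hu₀ v hv)).2]⟩
  have h1 : sSup U ≤ sInf V + r := csSup_le ⟨u₀, hu₀⟩ fun u hu => by
    have : u - r ≤ sInf V := le_csInf ⟨v₀, hv₀⟩ fun v hv => by
      linarith [(abs_le.1 (h u hu v hv)).2]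
    linarith
  have h2 : sSup V ≤ sInf U + r := csSup_le ⟨v₀, hv₀⟩ fun v hv => by
    have : v - r ≤ sInf U := le_csInf ⟨u₀, hu₀⟩ fun u hu => by
      linarith [(abs_le.1 (h u hu v hv)).1]
    linarith
  have hU' : sInf U ≤ sSup U := (csInf_le hUb hu₀).trans (le_csSup hUa hu₀)
  have hV' : sInf V ≤ sSup V := (csInf_le hVb hv₀).trans (le_csSup hVa hv₀)
  calc volume U + volume V
      ≤ volume (Set.Icc (sInf U) (sSup U)) + volume (Set.Icc (sInf V) (sSup V)) :=
        add_le_add (measure_mono (subset_Icc_csInf_csSup hUb hUa))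
          (measure_mono (subset_Icc_csInf_csSup hVb hVa))
    _ = ENNReal.ofReal ((sSup U - sInf U) + (sSup V - sInf V)) := by
        rw [Real.volume_Icc, Real.volume_Icc,
          ENNReal.ofReal_add (by linarith) (by linarith)]
    _ ≤ ENNReal.ofReal (2 * r) := ENNReal.ofReal_le_ofReal (by linarith)

lemma Complex.volume_eq_lintegral_volume_section {S : Set ℂ} (hS : MeasurableSet S) :
    volume S = ∫⁻ y : ℝ, volume {x : ℝ | (⟨x, y⟩ : ℂ) ∈ S} := by
  rw [← (Complex.volume_preserving_equiv_real_prod.symm).measure_preimage hS.nullMeasurableSet,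
    Measure.volume_eq_prod, Measure.prod_apply_symm
      (Complex.measurableEquivRealProd.symm.measurable hS)]
  rfl

lemma Complex.normSq_sub_le_of_dist_le {a b : ℂ} {r : ℝ} (h : dist a b ≤ r) :
    (a.re - b.re) ^ 2 + (a.im - b.im) ^ 2 ≤ r ^ 2 := by
  rw [Complex.dist_eq_re_im] at h
  exact (Real.sqrt_le_left ((Real.sqrt_nonneg _).trans h)).1 h

lemma Complex.le_normSq_sub_of_le_dist {a b : ℂ} {r : ℝ} (hr : 0 ≤ r) (h : r ≤ dist a b) :
    r ^ 2 ≤ (a.re - b.re) ^ 2 + (a.im - b.im) ^ 2 := by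
  rw [Complex.dist_eq_re_im] at h
  have := pow_le_pow_left₀ hr h 2
  rwa [Real.sq_sqrt (by positivity)] at this

/-- Steiner-type bound for a set of diameter at most `2` lying in an annulus of inner radius `2`
around the origin and spreading equally far above and below the real axis. -/
lemma volume_le_of_balanced {K : Set ℂ} (hK : IsCompact K) {d : ℝ}
    (hdiam : ∀ a ∈ K, ∀ b ∈ K, dist a b ≤ 2) (hin : ∀ a ∈ K, 2 ≤ dist a 0)
    (hout : ∀ a ∈ K, dist a 0 ≤ d) {a b : ℂ} (ha : a ∈ K) (hb : b ∈ K)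
    (hmax : ∀ z ∈ K, |z.im| ≤ a.im) (hab : b.im = -a.im) :
    volume K ≤ ∫⁻ y in Set.Icc (-1 : ℝ) 1,
      ENNReal.ofReal (min (2 * √(1 - y ^ 2)) (d - 2 * √(1 - y ^ 2))) := by
  set l : ℝ → ENNReal := fun y => volume {x : ℝ | (⟨x, y⟩ : ℂ) ∈ K} with hl
  have hd : 2 ≤ d := (hin a ha).trans (hout a ha)
  have hbounds : ∀ z ∈ K, 4 ≤ z.re ^ 2 + z.im ^ 2 ∧ z.re ^ 2 + z.im ^ 2 ≤ d ^ 2 := fun z hz => by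
    have h1 := Complex.le_normSq_sub_of_le_dist (by norm_num) (hin z hz)
    have h2 := Complex.normSq_sub_le_of_dist_le (hout z hz)
    simp only [Complex.zero_re, Complex.zero_im, sub_zero] at h1 h2
    exact ⟨by linarith, h2⟩
  have hh : a.im ≤ 1 := by
    have := Complex.normSq_sub_le_of_dist_le (hdiam a ha b hb)
    rw [hab] at this
    nlinarith [sq_nonneg (a.re - b.re)]
  have hh0 : 0 ≤ a.im := (abs_nonneg _).trans (hmax a ha)
  have hdist : ∀ z ∈ K, ∀ w ∈ K, (z.re - w.re) ^ 2 + (z.im - w.im) ^ 2 ≤ 4 := fun z hz w hw => by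
    have := Complex.normSq_sub_le_of_dist_le (hdiam z hz w hw)
    linarith
  have hempty : ∀ y : ℝ, y ∉ Set.Icc (-1 : ℝ) 1 → l y = 0 := fun y hy => by
    have : {x : ℝ | (⟨x, y⟩ : ℂ) ∈ K} = ∅ := by
      refine Set.eq_empty_iff_forall_notMem.2 fun x hx => hy ?_
      have := abs_le.1 ((hmax _ hx).trans hh)
      exact this
    simp only [hl, this, measure_empty]
  have hstrip : ∀ y ∈ Set.Icc (-1 : ℝ) 1, l y ≤ ENNReal.ofReal (d - 2 * √(1 - y ^ 2)) := by
    intro y hy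
    have hy2 : y ^ 2 ≤ 1 := by nlinarith [hy.1, hy.2]
    have hc := Real.sq_sqrt (sub_nonneg.2 hy2)
    have hc0 := Real.sqrt_nonneg (1 - y ^ 2)
    refine (Real.volume_le_diam _).trans (Metric.ediam_le fun x₁ h₁ x₂ h₂ => ?_)
    rw [edist_dist]
    refine ENNReal.ofReal_le_ofReal ?_
    have hx := hdist _ h₁ _ h₂
    obtain ⟨p1, p2⟩ := hbounds _ h₁
    obtain ⟨q1, q2⟩ := hbounds _ h₂
    simp only at hx p1 p2 q1 q2
    have key : ∀ x : ℝ, 4 ≤ x ^ 2 + y ^ 2 → x ^ 2 + y ^ 2 ≤ d ^ 2 →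
        2 * √(1 - y ^ 2) ≤ |x| ∧ |x| ≤ d ∧ 3 / 2 ≤ |x| := fun x h1 h2 => by
      refine ⟨abs_le_of_sq_le_sq' ?_ (abs_nonneg x) |>.2, abs_le_of_sq_le_sq' ?_ (by linarith) |>.2,
        abs_le_of_sq_le_sq' ?_ (abs_nonneg x) |>.2⟩ <;> rw [sq_abs] <;> nlinarith
    obtain ⟨a1, a2, a3⟩ := key x₁ p1 p2
    obtain ⟨b1, b2, b3⟩ := key x₂ q1 q2
    have hx' : |x₁ - x₂| ≤ 2 := abs_le_of_sq_le_sq (by linarith [sq_nonneg (y - y)]) (by norm_num)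
    rw [Real.dist_eq]
    rcases abs_cases x₁ with ⟨e1, _⟩ | ⟨e1, _⟩ <;> rcases abs_cases x₂ with ⟨e2, _⟩ | ⟨e2, _⟩ <;>
      rcases abs_cases (x₁ - x₂) with ⟨e3, _⟩ | ⟨e3, _⟩ <;> linarith
  have hone : ∀ y ∈ Set.Icc (-1 : ℝ) 1, l y ≤ ENNReal.ofReal (4 * √(1 - y ^ 2)) := by
    intro y hy
    have hy2 : y ^ 2 ≤ 1 := by nlinarith [hy.1, hy.2]
    rcases Set.eq_empty_or_nonempty {x : ℝ | (⟨x, y⟩ : ℂ) ∈ K} with he | ⟨x₀, hx₀⟩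
    · simp [hl, he]
    have hya : |y| ≤ a.im := hmax _ hx₀
    obtain ⟨ξ, hξ⟩ : ∃ ξ : ℂ, ξ.im = -y ∧ ∀ z ∈ K, dist ξ z ≤ 2 := by
      have hmem : -y ∈ segment ℝ b.im a.im := by
        rw [segment_eq_Icc (by linarith), hab]
        exact ⟨by linarith [(abs_le.1 hya).2], by linarith [(abs_le.1 hya).1]⟩
      obtain ⟨s, t, hs, ht, hst, he⟩ := hmem
      refine ⟨s • b + t • a, by simpa using he, fun z hz => ?_⟩
      exact (convex_closedBall z 2) (Metric.mem_closedBall.2 (hdiam b hb z hz))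
        (Metric.mem_closedBall.2 (hdiam a ha z hz)) hs ht hst
    calc l y ≤ volume (Metric.closedBall ξ.re (2 * √(1 - y ^ 2))) := by
          refine measure_mono fun x hx => ?_
          have := Complex.normSq_sub_le_of_dist_le (hξ.2 _ hx)
          simp only [hξ.1] at this
          rw [Metric.mem_closedBall, Real.dist_eq]
          refine abs_le_of_sq_le_sq ?_ (by positivity)
          rw [mul_pow, Real.sq_sqrt (sub_nonneg.2 hy2)]
          nlinarith
      _ = _ := by rw [Real.volume_closedBall]; ring_nf
  have hpair : ∀ y ∈ Set.Icc (-1 : ℝ) 1, l y + l (-y) ≤ ENNReal.ofReal (4 * √(1 - y ^ 2)) := by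
    intro y hy
    have hy2 : y ^ 2 ≤ 1 := by nlinarith [hy.1, hy.2]
    have hy' : -y ∈ Set.Icc (-1 : ℝ) 1 := ⟨by linarith [hy.2], by linarith [hy.1]⟩
    rcases Set.eq_empty_or_nonempty {x : ℝ | (⟨x, y⟩ : ℂ) ∈ K} with he | hU
    · have : l y = 0 := by simp [hl, he]
      rw [this, zero_add]
      simpa using hone _ hy'
    rcases Set.eq_empty_or_nonempty {x : ℝ | (⟨x, -y⟩ : ℂ) ∈ K} with he | hV
    · have : l (-y) = 0 := by simp [hl, he]
      rw [this, add_zero]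
      exact hone _ hy
    have := volume_add_volume_le_of_abs_sub_le_s4 (r := 2 * √(1 - y ^ 2)) hU hV fun u hu v hv => by
      have := hdist _ hu _ hv
      simp only at this
      refine abs_le_of_sq_le_sq ?_ (by positivity)
      rw [mul_pow, Real.sq_sqrt (sub_nonneg.2 hy2)]
      nlinarith
    refine this.trans_eq ?_
    ring_nf
  set m : ℝ → ENNReal := fun y =>
    ENNReal.ofReal (min (2 * √(1 - y ^ 2)) (d - 2 * √(1 - y ^ 2))) with hm
  have hsum : ∀ y, l y + l (-y) ≤ (Set.Icc (-1 : ℝ) 1).indicator (fun y => 2 * m y) y := by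
    intro y
    by_cases hy : y ∈ Set.Icc (-1 : ℝ) 1
    · have hy' : -y ∈ Set.Icc (-1 : ℝ) 1 := ⟨by linarith [hy.2], by linarith [hy.1]⟩
      rw [Set.indicator_of_mem hy]
      rcases min_choice (2 * √(1 - y ^ 2)) (d - 2 * √(1 - y ^ 2)) with h | h
      · refine (hpair y hy).trans_eq ?_
        simp only [hm, h]
        rw [show (2 : ENNReal) = ENNReal.ofReal 2 by simp, ← ENNReal.ofReal_mul (by norm_num)]
        ring_nf
      · simp only [hm, h, two_mul (ENNReal.ofReal _)]
        exact add_le_add (hstrip y hy) (by simpa using hstrip _ hy')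
    · have hy' : -y ∉ Set.Icc (-1 : ℝ) 1 := fun h => hy ⟨by linarith [h.2], by linarith [h.1]⟩
      rw [hempty y hy, hempty _ hy']
      simp
  have hvol := Complex.volume_eq_lintegral_volume_section hK.measurableSet
  have hlmeas : Measurable l :=
    measurable_measure_prodMk_right
      (Complex.measurableEquivRealProd.symm.measurable hK.measurableSet)
  have hneg : ∫⁻ y, l (-y) = ∫⁻ y, l y :=
    (Measure.measurePreserving_neg volume).lintegral_comp hlmeas
  have htwo : 2 * volume K ≤ 2 * ∫⁻ y in Set.Icc (-1 : ℝ) 1, m y := by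
    calc 2 * volume K = ∫⁻ y, (l y + l (-y)) := by
          rw [lintegral_add_left hlmeas, hneg, ← two_mul, hvol]
      _ ≤ ∫⁻ y, (Set.Icc (-1 : ℝ) 1).indicator (fun y => 2 * m y) y := lintegral_mono hsum
      _ = _ := by
          rw [lintegral_indicator measurableSet_Icc, lintegral_const_mul' _ _ (by norm_num)]
  exact (ENNReal.mul_le_mul_iff_right (by norm_num) (by norm_num)).1 htwo

/-- The rigid motion `z ↦ w * z + q` of the complex plane preserves area. -/
lemma Complex.measurePreserving_circle_mul_add (w : Circle) (q : ℂ) :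
    MeasurePreserving (fun z : ℂ => (w : ℂ) * z + q) :=
  (measurePreserving_add_right volume q).comp (rotation w).measurePreserving

lemma Complex.dist_circle_mul_add (w : Circle) (q a b : ℂ) :
    dist ((w : ℂ) * a + q) ((w : ℂ) * b + q) = dist a b := by
  rw [dist_add_right, dist_eq_norm, ← mul_sub, norm_mul, Circle.norm_coe, one_mul, dist_eq_norm]

/-- Some rotation about the origin makes a compact set spread equally far above and below the
real axis. -/
lemma exists_circle_mul_balanced {K : Set ℂ} (hK : IsCompact K) (hne : K.Nonempty) :
    ∃ w : Circle, ∃ a ∈ K, ∃ b ∈ K, ((w : ℂ) * b).im = -((w : ℂ) * a).im ∧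
      ∀ z ∈ K, |((w : ℂ) * z).im| ≤ ((w : ℂ) * a).im := by
  set g : ℝ → ℂ → ℝ := fun t z => ((Circle.exp t : ℂ) * z).im with hg
  have hgc : Continuous ↿g := by
    simp only [hg, Function.HasUncurry.uncurry, id]
    fun_prop
  have hgt : ∀ t, Continuous (g t) := fun t => hgc.comp (by fun_prop : Continuous fun z => (t, z))
  set F : ℝ → ℝ := fun t => sSup (g t '' K) with hF
  have hFc : Continuous F := hK.continuous_sSup hgc
  have hgpi : ∀ t z, g (t + Real.pi) z = -g t z := fun t z => by
    simp [hg]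
    ring
  have hle : ∀ t, ∀ z ∈ K, g t z ≤ F t := fun t z hz =>
    le_csSup (hK.image (hgt t)).bddAbove (Set.mem_image_of_mem _ hz)
  have hF2 : F (0 + Real.pi + Real.pi) = F 0 := by
    have : g (0 + Real.pi + Real.pi) = g 0 := by
      funext z
      rw [hgpi, hgpi, neg_neg]
    simp only [hF, this]
  obtain ⟨t, ht⟩ : ∃ t, F t - F (t + Real.pi) = 0 := by
    have hc : Continuous fun t => F t - F (t + Real.pi) := by fun_prop
    rcases le_total (F 0 - F (0 + Real.pi)) 0 with h | h
    · exact mem_range_of_exists_le_of_exists_ge hc ⟨0, h⟩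
        ⟨0 + Real.pi, by rw [hF2]; linarith⟩
    · exact mem_range_of_exists_le_of_exists_ge hc
        ⟨0 + Real.pi, by rw [hF2]; linarith⟩ ⟨0, h⟩
  obtain ⟨a, ha, hFa⟩ := hK.exists_sSup_image_eq hne (hgt t).continuousOn
  obtain ⟨b, hb, hFb⟩ := hK.exists_sSup_image_eq hne (hgt (t + Real.pi)).continuousOn
  have hFa' : F t = g t a := hFa
  have hFb' : F (t + Real.pi) = -g t b := hFb.trans (hgpi t b)
  refine ⟨Circle.exp t, a, ha, b, hb, ?_, fun z hz => abs_le.2 ⟨?_, ?_⟩⟩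
  · change g t b = -g t a
    linarith
  · change -g t a ≤ g t z
    have := hle (t + Real.pi) z hz
    rw [hgpi] at this
    linarith
  · exact (hle t z hz).trans_eq hFa'

/-- The area of a set of diameter at most `2` in an annulus of radii `2` and `d`. -/
lemma volume_le_of_diam_le_of_annulus {T : Set ℂ} {q : ℂ} {d : ℝ}
    (hdiam : ∀ a ∈ T, ∀ b ∈ T, dist a b ≤ 2) (hin : ∀ a ∈ T, 2 ≤ dist a q)
    (hout : ∀ a ∈ T, dist a q ≤ d) :
    volume T ≤ ∫⁻ y in Set.Icc (-1 : ℝ) 1,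
      ENNReal.ofReal (min (2 * √(1 - y ^ 2)) (d - 2 * √(1 - y ^ 2))) := by
  rcases T.eq_empty_or_nonempty with rfl | hne
  · simp
  set K := closure T with hKT
  have hin' : ∀ a ∈ K, 2 ≤ dist a q := fun a ha =>
    closure_minimal (t := {a | 2 ≤ dist a q}) hin
      (isClosed_le continuous_const (continuous_id.dist continuous_const)) ha
  have hout' : ∀ a ∈ K, dist a q ≤ d := fun a ha =>
    closure_minimal hout (Metric.isClosed_closedBall (x := q) (ε := d)) ha
  have hdiam₁ : ∀ a ∈ K, ∀ b ∈ T, dist a b ≤ 2 := fun a ha b hb =>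
    closure_minimal (fun z hz => hdiam z hz b hb) (Metric.isClosed_closedBall (x := b) (ε := 2)) ha
  have hdiam' : ∀ a ∈ K, ∀ b ∈ K, dist a b ≤ 2 := fun a ha b hb =>
    Metric.mem_closedBall'.1 (closure_minimal
      (fun z hz => Metric.mem_closedBall'.2 (hdiam₁ a ha z hz)) Metric.isClosed_closedBall hb)
  have hK : IsCompact K := Metric.isCompact_of_isClosed_isBounded isClosed_closure
    (Metric.isBounded_closedBall.subset hout')
  set K' : Set ℂ := (fun z => z - q) '' K with hK'
  have hK'c : IsCompact K' := hK.image (by fun_prop)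
  obtain ⟨w, a, ha, b, hb, hab, hmax⟩ :=
    exists_circle_mul_balanced hK'c (hne.closure.image _)
  set φ : ℂ → ℂ := fun z => ((w⁻¹ : Circle) : ℂ) * z + q with hφ
  set L : Set ℂ := (fun z => (w : ℂ) * z) '' K' with hL
  have hLK : ∀ z ∈ L, φ z ∈ K := by
    rintro _ ⟨_, ⟨z, hz, rfl⟩, rfl⟩
    simpa [hφ] using hz
  have hpre : φ ⁻¹' K ⊆ L := fun z hz => ⟨_, ⟨_, hz, rfl⟩, by simp [hφ]⟩
  have hq : φ 0 = q := by simp [hφ]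
  have hisom : ∀ x y, dist (φ x) (φ y) = dist x y := Complex.dist_circle_mul_add _ _
  calc volume T ≤ volume K := measure_mono subset_closure
    _ = volume (φ ⁻¹' K) :=
      ((Complex.measurePreserving_circle_mul_add w⁻¹ q).measure_preimage
        hK.measurableSet.nullMeasurableSet).symm
    _ ≤ volume L := measure_mono hpre
    _ ≤ _ := by
      refine volume_le_of_balanced (hK'c.image (by fun_prop)) ?_ ?_ ?_
        (Set.mem_image_of_mem _ ha) (Set.mem_image_of_mem _ hb) ?_ hab
      · intro x hx y hy
        rw [← hisom]
        exact hdiam' _ (hLK x hx) _ (hLK y hy)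
      · intro x hx
        rw [← hisom, hq]
        exact hin' _ (hLK x hx)
      · intro x hx
        rw [← hisom, hq]
        exact hout' _ (hLK x hx)
      · rintro _ ⟨z, hz, rfl⟩
        exact hmax z hz

/-- The area of the intersection of two discs of radius `2`. -/
lemma volume_closedBall_inter_closedBall_le_s4 {p q : ℂ} (hpq : p ≠ q) :
    volume (Metric.closedBall p 2 ∩ Metric.closedBall q 2) ≤ ∫⁻ y in Set.Icc (-1 : ℝ) 1,
      ENNReal.ofReal (2 * (4 * √(1 - y ^ 2) - dist p q)) := by
  set d := dist p q with hd
  have hd0 : 0 < d := dist_pos.2 hpq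
  obtain ⟨w, hw⟩ : ∃ w : Circle, (w : ℂ) * d = q - p := by
    have hd' : (d : ℂ) ≠ 0 := by exact_mod_cast hd0.ne'
    refine ⟨⟨(q - p) / d, ?_⟩, by simp [hd']⟩
    refine mem_sphere_zero_iff_norm.2 ?_
    rw [norm_div, Complex.norm_real, ← dist_eq_norm, dist_comm, ← hd,
      Real.norm_of_nonneg hd0.le, div_self hd0.ne']
  have hmeas : MeasurableSet (Metric.closedBall p 2 ∩ Metric.closedBall q 2) :=
    Metric.isClosed_closedBall.measurableSet.inter Metric.isClosed_closedBall.measurableSet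
  set φ : ℂ → ℂ := fun z => (w : ℂ) * z + p with hφ
  have hp : φ 0 = p := by simp [hφ]
  have hq : φ d = q := by simp [hφ, hw]
  have hisom : ∀ x y, dist (φ x) (φ y) = dist x y := Complex.dist_circle_mul_add _ _
  set L : Set ℂ := φ ⁻¹' (Metric.closedBall p 2 ∩ Metric.closedBall q 2) with hL
  have hLmeas : MeasurableSet L := (by fun_prop : Measurable φ) hmeas
  have hvol : volume L = volume (Metric.closedBall p 2 ∩ Metric.closedBall q 2) :=
    (Complex.measurePreserving_circle_mul_add w p).measure_preimage hmeas.nullMeasurableSet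
  have hL' : ∀ z ∈ L, z.re ^ 2 + z.im ^ 2 ≤ 4 ∧ (z.re - d) ^ 2 + z.im ^ 2 ≤ 4 := by
    rintro z ⟨h1, h2⟩
    rw [Metric.mem_closedBall, ← hp, hisom] at h1
    rw [Metric.mem_closedBall, ← hq, hisom] at h2
    have h1' := Complex.normSq_sub_le_of_dist_le h1
    have h2' := Complex.normSq_sub_le_of_dist_le h2
    simp only [Complex.zero_re, Complex.zero_im, sub_zero, Complex.ofReal_re,
      Complex.ofReal_im] at h1' h2'
    exact ⟨by linarith, by linarith⟩
  set H : Set ℂ := (fun z : ℂ => (2 : ℝ) • z) ⁻¹' L with hH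
  have hHmeas : MeasurableSet H := (by fun_prop : Measurable fun z : ℂ => (2 : ℝ) • z) hLmeas
  have hscale : volume L = 4 * volume H := by
    rw [hH, Measure.addHaar_preimage_smul _ (by norm_num), Complex.finrank_real_complex,
      ← mul_assoc, show (4 : ENNReal) = ENNReal.ofReal 4 by simp,
      ← ENNReal.ofReal_mul (by norm_num)]
    norm_num
  have hsec : ∀ y : ℝ, volume {x : ℝ | (⟨x, y⟩ : ℂ) ∈ H} ≤ (Set.Icc (-1 : ℝ) 1).indicator
      (fun y => ENNReal.ofReal (2 * √(1 - y ^ 2) - d / 2)) y := by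
    intro y
    have hmem : ∀ x : ℝ, (⟨x, y⟩ : ℂ) ∈ H → x ^ 2 + y ^ 2 ≤ 1 ∧ (x - d / 2) ^ 2 + y ^ 2 ≤ 1 := by
      intro x hx
      have := hL' _ hx
      simp only [Complex.smul_re, Complex.smul_im, smul_eq_mul] at this
      exact ⟨by nlinarith, by nlinarith⟩
    by_cases hy : y ∈ Set.Icc (-1 : ℝ) 1
    · rw [Set.indicator_of_mem hy]
      refine (measure_mono (t := Set.Icc (d / 2 - √(1 - y ^ 2)) √(1 - y ^ 2)) fun x hx => ?_).trans
        ?_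
      · obtain ⟨h1, h2⟩ := hmem x hx
        have h3 := Real.abs_le_sqrt (x := x) (y := 1 - y ^ 2) (by linarith)
        have h4 := Real.abs_le_sqrt (x := x - d / 2) (y := 1 - y ^ 2) (by linarith)
        exact ⟨by linarith [(abs_le.1 h4).1], (abs_le.1 h3).2⟩
      · rw [Real.volume_Icc]
        exact ENNReal.ofReal_le_ofReal (by linarith)
    · have : {x : ℝ | (⟨x, y⟩ : ℂ) ∈ H} = ∅ := by
        refine Set.eq_empty_iff_forall_notMem.2 fun x hx => hy ?_
        have := (hmem x hx).1
        exact abs_le.1 (abs_le_of_sq_le_sq (by nlinarith [sq_nonneg x]) zero_le_one)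
      simp [this]
  rw [← hvol, hscale, Complex.volume_eq_lintegral_volume_section hHmeas]
  calc 4 * ∫⁻ y : ℝ, volume {x : ℝ | (⟨x, y⟩ : ℂ) ∈ H}
      ≤ 4 * ∫⁻ y, (Set.Icc (-1 : ℝ) 1).indicator
        (fun y => ENNReal.ofReal (2 * √(1 - y ^ 2) - d / 2)) y := by
        gcongr with y
        exact hsec y
    _ = _ := by
      rw [lintegral_indicator measurableSet_Icc, ← lintegral_const_mul' _ _ (by norm_num)]
      refine lintegral_congr fun y => ?_
      rw [show (4 : ENNReal) = ENNReal.ofReal 4 by simp, ← ENNReal.ofReal_mul (by norm_num)]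
      ring_nf

lemma lintegral_ofReal_mul_sqrt_one_sub_sq {k : ℝ} (hk : 0 ≤ k) :
    ∫⁻ y in Set.Icc (-1 : ℝ) 1, ENNReal.ofReal (k * √(1 - y ^ 2)) =
      ENNReal.ofReal (k * (Real.pi / 2)) := by
  rw [← ofReal_integral_eq_lintegral_ofReal, integral_Icc_eq_integral_Ioc,
    ← intervalIntegral.integral_of_le (by norm_num), intervalIntegral.integral_const_mul,
    integral_sqrt_one_sub_sq]
  · exact Continuous.integrableOn_Icc (by fun_prop)
  · exact Filter.Eventually.of_forall fun y => by positivity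

/-- No three points of `A` have all pairwise distances greater than `2`. -/
def LargeDistTriangleFree {X : Type*} [Dist X] (A : Set X) : Prop :=
  ∀ x ∈ A, ∀ y ∈ A, ∀ z ∈ A, 2 < dist x y → 2 < dist x z → dist y z ≤ 2

namespace LargeDistTriangleFree

lemma closure {A : Set ℂ} (hA : LargeDistTriangleFree A) :
    LargeDistTriangleFree (closure A) := by
  intro x hx y hy z hz hxy hxz
  by_contra! hyz
  obtain ⟨u, hu, hux⟩ := mem_closure_iff_seq_limit.1 hx
  obtain ⟨v, hv, hvy⟩ := mem_closure_iff_seq_limit.1 hy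
  obtain ⟨s, hs, hsz⟩ := mem_closure_iff_seq_limit.1 hz
  obtain ⟨n, ⟨h1, h2⟩, h3⟩ := (((hux.dist hvy).eventually_const_lt hxy).and
    ((hux.dist hsz).eventually_const_lt hxz) |>.and
    ((hvy.dist hsz).eventually_const_lt hyz)).exists
  exact h3.not_ge (hA _ (hu n) _ (hv n) _ (hs n) h1 h2)

lemma volume_neighbors_le_lintegral {A : Set ℂ} (hA : LargeDistTriangleFree A) {q : ℂ} (hq : q ∈ A)
    {d : ℝ} (hd : ∀ z ∈ A, dist q z ≤ d) :
    volume {z ∈ A | 2 < dist q z} ≤ ∫⁻ y in Set.Icc (-1 : ℝ) 1,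
      ENNReal.ofReal (min (2 * √(1 - y ^ 2)) (d - 2 * √(1 - y ^ 2))) :=
  volume_le_of_diam_le_of_annulus (q := q) (fun a ha b hb => hA q hq a ha.1 b hb.1 ha.2 hb.2)
    (fun a ha => by rw [dist_comm]; exact ha.2.le) fun a ha => by rw [dist_comm]; exact hd a ha.1

lemma volume_neighbors_le {A : Set ℂ} (hA : LargeDistTriangleFree A) {q : ℂ} (hq : q ∈ A) :
    volume {z ∈ A | 2 < dist q z} ≤ ENNReal.ofReal Real.pi := by
  rcases Set.eq_empty_or_nonempty {z ∈ A | 2 < dist q z} with h | ⟨a, ha⟩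
  · simp [h]
  calc volume {z ∈ A | 2 < dist q z}
      ≤ ∫⁻ y in Set.Icc (-1 : ℝ) 1,
        ENNReal.ofReal (min (2 * √(1 - y ^ 2)) (dist q a + 2 - 2 * √(1 - y ^ 2))) :=
        volume_le_of_diam_le_of_annulus (q := q)
          (fun x hx y hy => hA q hq x hx.1 y hy.1 hx.2 hy.2)
          (fun x hx => by rw [dist_comm]; exact hx.2.le) fun x hx => by
            have := hA q hq a ha.1 x hx.1 ha.2 hx.2
            linarith [dist_triangle_left x q a, dist_comm x q, dist_triangle q a x]
    _ ≤ ∫⁻ y in Set.Icc (-1 : ℝ) 1, ENNReal.ofReal (2 * √(1 - y ^ 2)) :=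
        lintegral_mono fun y => ENNReal.ofReal_le_ofReal (min_le_left _ _)
    _ = ENNReal.ofReal Real.pi := by
        rw [lintegral_ofReal_mul_sqrt_one_sub_sq (by norm_num)]
        ring_nf

lemma volume_le_of_isClosed {A : Set ℂ} (hA : LargeDistTriangleFree A) (hc : IsClosed A)
    (he : ∃ x ∈ A, ∃ y ∈ A, 2 < dist x y) : volume A ≤ ENNReal.ofReal (2 * Real.pi) := by
  by_cases hfar : ∃ x ∈ A, ∃ y ∈ A, 4 < dist x y
  · obtain ⟨x, hx, y, hy, hxy⟩ := hfar
    calc volume A ≤ volume ({z ∈ A | 2 < dist x z} ∪ {z ∈ A | 2 < dist y z}) := by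
          refine measure_mono fun z hz => ?_
          by_contra hcon
          simp only [Set.mem_union, Set.mem_ofPred_eq, hz, true_and, not_or, not_lt] at hcon
          linarith [dist_triangle_right x y z]
      _ ≤ ENNReal.ofReal Real.pi + ENNReal.ofReal Real.pi :=
          (measure_union_le _ _).trans
            (add_le_add (hA.volume_neighbors_le hx) (hA.volume_neighbors_le hy))
      _ = ENNReal.ofReal (2 * Real.pi) := by
          rw [← ENNReal.ofReal_add Real.pi_pos.le Real.pi_pos.le, two_mul]
  push Not at hfar
  obtain ⟨x, hx, y, hy, hxy⟩ := he
  have hcomp : IsCompact A := Metric.isCompact_of_isClosed_isBounded hc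
    (Metric.isBounded_closedBall.subset (s := A) (t := Metric.closedBall x 4) fun z hz =>
      hfar z hz x hx)
  obtain ⟨⟨p, q⟩, ⟨hp, hq⟩, hmax⟩ := (hcomp.prod hcomp).exists_isMaxOn ⟨(x, y), hx, hy⟩
    (f := fun u : ℂ × ℂ => dist u.1 u.2) (by fun_prop)
  have hd : ∀ u ∈ A, ∀ v ∈ A, dist u v ≤ dist p q := fun u hu v hv =>
    isMaxOn_iff.1 hmax (u, v) ⟨hu, hv⟩
  have hpq : 2 < dist p q := hxy.trans_le (hd x hx y hy)
  set d := dist p q with hd_def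
  have hmeas : Measurable fun y : ℝ =>
      ENNReal.ofReal (min (2 * √(1 - y ^ 2)) (d - 2 * √(1 - y ^ 2))) := by fun_prop
  calc volume A
      ≤ volume ({z ∈ A | 2 < dist p z} ∪ {z ∈ A | 2 < dist q z} ∪
        (Metric.closedBall p 2 ∩ Metric.closedBall q 2)) := by
        refine measure_mono fun z hz => ?_
        by_cases h1 : 2 < dist p z
        · exact Or.inl (Or.inl ⟨hz, h1⟩)
        by_cases h2 : 2 < dist q z
        · exact Or.inl (Or.inr ⟨hz, h2⟩)
        · exact Or.inr ⟨Metric.mem_closedBall'.2 (not_lt.1 h1),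
            Metric.mem_closedBall'.2 (not_lt.1 h2)⟩
    _ ≤ volume {z ∈ A | 2 < dist p z} + volume {z ∈ A | 2 < dist q z} +
        volume (Metric.closedBall p 2 ∩ Metric.closedBall q 2) :=
        (measure_union_le _ _).trans (add_le_add_left (measure_union_le _ _) _)
    _ ≤ _ := add_le_add (add_le_add (hA.volume_neighbors_le_lintegral hp (hd p hp))
        (hA.volume_neighbors_le_lintegral hq (hd q hq)))
        (volume_closedBall_inter_closedBall_le_s4 (dist_pos.1 (by linarith)))
    _ = ∫⁻ y in Set.Icc (-1 : ℝ) 1, ENNReal.ofReal (4 * √(1 - y ^ 2)) := by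
        rw [← lintegral_add_left hmeas, ← lintegral_add_right _ (by fun_prop)]
        refine lintegral_congr fun y => ?_
        have hc1 : √(1 - y ^ 2) ≤ 1 := Real.sqrt_le_one.2 (by nlinarith [sq_nonneg y])
        have hc0 : 0 ≤ √(1 - y ^ 2) := Real.sqrt_nonneg _
        have hm : 0 ≤ min (2 * √(1 - y ^ 2)) (d - 2 * √(1 - y ^ 2)) :=
          le_min (by linarith) (by linarith)
        rw [← ENNReal.ofReal_add hm hm]
        rcases le_total (4 * √(1 - y ^ 2)) d with h | h
        · rw [ENNReal.ofReal_of_nonpos (p := 2 * _) (by linarith), add_zero,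
            min_eq_left (by linarith)]
          ring_nf
        · rw [← ENNReal.ofReal_add (add_nonneg hm hm) (by linarith), min_eq_right (by linarith)]
          congr 1
          rw [hd_def]
          ring
    _ = ENNReal.ofReal (2 * Real.pi) := by
        rw [lintegral_ofReal_mul_sqrt_one_sub_sq (by norm_num)]
        ring_nf

/-- Mantel-type bound for the ordered edges of a triangle-free large-distance graph in the
complex plane. -/
lemma volume_edges_le {A : Set ℂ} (hA : LargeDistTriangleFree A) (hm : MeasurableSet A) :
    volume {p : ℂ × ℂ | p.1 ∈ A ∧ p.2 ∈ A ∧ 2 < dist p.1 p.2} ≤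
      ENNReal.ofReal (2 * Real.pi ^ 2) := by
  by_cases he : ∃ x ∈ A, ∃ y ∈ A, 2 < dist x y
  · obtain ⟨x, hx, y, hy, hxy⟩ := he
    have hvol : volume A ≤ ENNReal.ofReal (2 * Real.pi) :=
      (measure_mono subset_closure).trans (hA.closure.volume_le_of_isClosed isClosed_closure
        ⟨x, subset_closure hx, y, subset_closure hy, hxy⟩)
    have hE : MeasurableSet {p : ℂ × ℂ | p.1 ∈ A ∧ p.2 ∈ A ∧ 2 < dist p.1 p.2} :=
      (measurable_fst hm).inter ((measurable_snd hm).inter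
        (measurableSet_lt measurable_const (measurable_fst.dist measurable_snd)))
    rw [Measure.volume_eq_prod, Measure.prod_apply hE]
    calc ∫⁻ x, volume (Prod.mk x ⁻¹' {p : ℂ × ℂ | p.1 ∈ A ∧ p.2 ∈ A ∧ 2 < dist p.1 p.2})
        ≤ ∫⁻ x, A.indicator (fun _ => ENNReal.ofReal Real.pi) x := by
          refine lintegral_mono fun x => ?_
          by_cases hx : x ∈ A
          · rw [Set.indicator_of_mem hx]
            exact (measure_mono fun z hz => hz.2).trans (hA.volume_neighbors_le hx)
          · simp [hx]
      _ = ENNReal.ofReal Real.pi * volume A := lintegral_indicator_const hm _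
      _ ≤ ENNReal.ofReal Real.pi * ENNReal.ofReal (2 * Real.pi) := by gcongr
      _ = ENNReal.ofReal (2 * Real.pi ^ 2) := by
          rw [← ENNReal.ofReal_mul Real.pi_pos.le]
          ring_nf
  · push Not at he
    have : {p : ℂ × ℂ | p.1 ∈ A ∧ p.2 ∈ A ∧ 2 < dist p.1 p.2} = ∅ :=
      Set.eq_empty_iff_forall_notMem.2 fun p hp => (he _ hp.1 _ hp.2.1).not_gt hp.2.2
    simp [this]

end LargeDistTriangleFree

theorem stmt4 (A : Set (EuclideanSpace ℝ (Fin 2))) (hA : MeasurableSet A)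
    (hfree : ¬ ∃ x y z, x ∈ A ∧ y ∈ A ∧ z ∈ A ∧
      2 < dist x y ∧ 2 < dist x z ∧ 2 < dist y z) :
    (1 / 2) * volume {p : EuclideanSpace ℝ (Fin 2) × EuclideanSpace ℝ (Fin 2) |
        p.1 ∈ A ∧ p.2 ∈ A ∧ 2 < dist p.1 p.2}
      ≤ ENNReal.ofReal (Real.pi ^ 2) := by
  set e : ℂ ≃ₗᵢ[ℝ] EuclideanSpace ℝ (Fin 2) := Complex.orthonormalBasisOneI.repr with he
  have hB : LargeDistTriangleFree (e ⁻¹' A) := by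
    intro x hx y hy z hz hxy hxz
    by_contra! hyz
    exact hfree ⟨e x, e y, e z, hx, hy, hz, by simpa using hxy, by simpa using hxz,
      by simpa using hyz⟩
  have hE : MeasurableSet {p : EuclideanSpace ℝ (Fin 2) × EuclideanSpace ℝ (Fin 2) |
      p.1 ∈ A ∧ p.2 ∈ A ∧ 2 < dist p.1 p.2} :=
    (measurable_fst hA).inter ((measurable_snd hA).inter
      (measurableSet_lt measurable_const (measurable_fst.dist measurable_snd)))
  have hvol := hB.volume_edges_le (e.continuous.measurable hA)
  have hpre := (e.measurePreserving.prod e.measurePreserving).measure_preimage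
    hE.nullMeasurableSet
  have hset : Prod.map e e ⁻¹' {p : EuclideanSpace ℝ (Fin 2) × EuclideanSpace ℝ (Fin 2) |
      p.1 ∈ A ∧ p.2 ∈ A ∧ 2 < dist p.1 p.2} =
      {p : ℂ × ℂ | p.1 ∈ e ⁻¹' A ∧ p.2 ∈ e ⁻¹' A ∧ 2 < dist p.1 p.2} := by
    ext p
    simp
  rw [hset, ← Measure.volume_eq_prod, ← Measure.volume_eq_prod] at hpre
  rw [← hpre]
  calc 1 / 2 * volume {p : ℂ × ℂ | p.1 ∈ e ⁻¹' A ∧ p.2 ∈ e ⁻¹' A ∧ 2 < dist p.1 p.2}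
      ≤ 1 / 2 * ENNReal.ofReal (2 * Real.pi ^ 2) := by gcongr
    _ = ENNReal.ofReal (Real.pi ^ 2) := by
      rw [ENNReal.ofReal_mul (by norm_num), ENNReal.ofReal_ofNat, ← mul_assoc, one_div,
        ENNReal.inv_mul_cancel (by norm_num) (by norm_num), one_mul]
end
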